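/- Let (W,S) be an irreducible, infinite, non-affine Coxeter system of finite rank and let G be a subgroup of W of finite index. Then G cannot be expressed as an internal direct product A × B of two nontrivial subgroups A and B. -/

import Mathlib

namespace CoxeterPaper

/-- The entry `-cos (π / m i j)` of the matrix of the standard bilinear form,
interpreted as `-1` when `m i j = ∞` (encoded as `0`). -/
noncomputable def formEntry {B : Type*} (M : CoxeterMatrix B) (i j : B) : ℝ :=
  if M i j = 0 then -1 else - Real.cos (Real.pi / (M i j : ℝ))

/-- The standard bilinear form associated to a Coxeter matrix, on `V = B → ℝ`
(with basis `{α_s : s ∈ S}` identified with the standard basis). -/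
noncomputable def bilin {B : Type*} [Fintype B] (M : CoxeterMatrix B) (v w : B → ℝ) : ℝ :=
  ∑ i, ∑ j, v i * w j * formEntry M i j

/-- The standard bilinear form is positive definite. -/
def IsPosDef {B : Type*} [Fintype B] (M : CoxeterMatrix B) : Prop :=
  ∀ v : B → ℝ, v ≠ 0 → 0 < bilin M v v

/-- The standard bilinear form is positive semidefinite. -/
def IsPosSemidef {B : Type*} [Fintype B] (M : CoxeterMatrix B) : Prop :=
  ∀ v : B → ℝ, 0 ≤ bilin M v v

/-- The Coxeter graph: vertices are the elements of `B`, and `i ≠ j` are adjacent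
iff `m i j ≥ 3` (including `m i j = ∞`, encoded as `0`), i.e. iff `m i j ≠ 2`. -/
def coxeterGraph {B : Type*} (M : CoxeterMatrix B) : SimpleGraph B :=
  SimpleGraph.fromRel fun i j => M i j ≠ 2

/-- A Coxeter matrix (system) is irreducible if its Coxeter graph is connected. -/
def IsIrreducible {B : Type*} (M : CoxeterMatrix B) : Prop := (coxeterGraph M).Connected

theorem formEntry_symm {B : Type*} (M : CoxeterMatrix B) (i j : B) :
    formEntry M i j = formEntry M j i := by
  simp only [formEntry, M.symmetric i j]

theorem formEntry_self {B : Type*} (M : CoxeterMatrix B) (i : B) : formEntry M i i = 1 := by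
  simp [formEntry]

theorem formEntry_nonpos {B : Type*} (M : CoxeterMatrix B) {i j : B} (h : i ≠ j) :
    formEntry M i j ≤ 0 := by
  unfold formEntry
  split_ifs with h0
  · norm_num
  · have h1 := M.off_diagonal i j h
    have h2 : (2 : ℝ) ≤ M i j := by exact_mod_cast (by omega : 2 ≤ M i j)
    have : 0 ≤ Real.cos (Real.pi / M i j) := by
      apply Real.cos_nonneg_of_mem_Icc
      have := Real.pi_pos
      constructor
      · have : 0 ≤ Real.pi / M i j := by positivity
        linarith
      · gcongr
    linarith

theorem formEntry_neg {B : Type*} (M : CoxeterMatrix B) {i j : B} (h : i ≠ j)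
    (h2 : M i j ≠ 2) : formEntry M i j < 0 := by
  unfold formEntry
  split_ifs with h0
  · norm_num
  · have h1 := M.off_diagonal i j h
    have h2 : (2 : ℝ) < M i j := by exact_mod_cast (by omega : 2 < M i j)
    have : 0 < Real.cos (Real.pi / M i j) := by
      apply Real.cos_pos_of_mem_Ioo
      have := Real.pi_pos
      constructor
      · have : 0 ≤ Real.pi / M i j := by positivity
        linarith
      · gcongr
    linarith

theorem neg_one_le_formEntry {B : Type*} (M : CoxeterMatrix B) (i j : B) :
    -1 ≤ formEntry M i j := by
  unfold formEntry
  split_ifs with h0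
  · exact le_rfl
  · linarith [Real.cos_le_one (Real.pi / M i j)]

theorem formEntry_le_one {B : Type*} (M : CoxeterMatrix B) (i j : B) :
    formEntry M i j ≤ 1 := by
  unfold formEntry
  split_ifs with h0
  · norm_num
  · linarith [Real.neg_one_le_cos (Real.pi / M i j)]

/-- A real vector space with a symmetric bilinear form and a family of vectors whose Gram matrix
is the matrix of the standard bilinear form of a Coxeter matrix. -/
structure RootSpace {B : Type*} (M : CoxeterMatrix B) (V : Type*) [AddCommGroup V]
    [Module ℝ V] where
  /-- The bilinear form. -/
  form : V →ₗ[ℝ] V →ₗ[ℝ] ℝ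
  symm : ∀ x y, form x y = form y x
  /-- The simple roots. -/
  root : B → V
  gram : ∀ i j, form (root i) (root j) = formEntry M i j

namespace RootSpace

variable {B W V : Type*} [Group W] {M : CoxeterMatrix B} [AddCommGroup V] [Module ℝ V]
  (R : RootSpace M V) (cs : CoxeterSystem M W)

theorem form_root_self (i : B) : R.form (R.root i) (R.root i) = 1 := by
  rw [R.gram, formEntry_self]

/-- The orthogonal reflection in a simple root. -/
noncomputable def refl (i : B) : Module.End ℝ V :=
  LinearMap.id - (2 : ℝ) • (R.form (R.root i)).smulRight (R.root i)

theorem refl_apply (i : B) (x : V) :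
    R.refl i x = x - (2 * R.form (R.root i) x) • R.root i := by
  simp [refl, smul_smul]

theorem refl_root_self (i : B) : R.refl i (R.root i) = -R.root i := by
  rw [refl_apply, form_root_self]; module

theorem refl_root (i j : B) :
    R.refl i (R.root j) = R.root j - (2 * formEntry M i j) • R.root i := by
  rw [refl_apply, gram]

theorem refl_refl (i : B) (x : V) : R.refl i (R.refl i x) = x := by
  simp only [refl_apply, map_sub, map_smul, form_root_self]; module

theorem form_refl (i : B) (x y : V) : R.form (R.refl i x) (R.refl i y) = R.form x y := by
  simp only [refl_apply, map_sub, map_smul, form_root_self, smul_eq_mul, LinearMap.sub_apply,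
    LinearMap.smul_apply, R.symm x (R.root i)]
  ring

theorem isLiftable : M.IsLiftable R.refl := by
  intro i j
  by_cases h0 : M i j = 0
  · simp [h0]
  by_cases hij : i = j
  · subst hij
    ext x
    simp [refl_refl]
  have hM : 2 ≤ M i j := by have := M.off_diagonal i j hij; omega
  have hM' : (2 : ℝ) ≤ M i j := by exact_mod_cast hM
  set θ : ℝ := Real.pi / M i j with hθ
  have hG : formEntry M i j = -Real.cos θ := by simp [formEntry, h0, hθ]
  have hG' : formEntry M j i = -Real.cos θ := by rw [formEntry_symm, hG]
  have hπ := Real.pi_pos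
  have hsin : 0 < Real.sin θ := by
    apply Real.sin_pos_of_pos_of_lt_pi
    · positivity
    · rw [hθ, div_lt_iff₀ (by linarith)]; nlinarith
  let u : ℝ → V := fun x => Real.sin x • R.root j + Real.sin (x + θ) • R.root i
  have hrec : ∀ x, Real.sin (x + 2 * θ) = 2 * Real.cos θ * Real.sin (x + θ) - Real.sin x := by
    intro x
    have h1 : x + 2 * θ = (x + θ) + θ := by ring
    have h2 : Real.sin x = Real.sin ((x + θ) - θ) := by ring_nf
    rw [h1, h2, Real.sin_add (x + θ), Real.sin_sub]; ring
  have hu : ∀ x, R.refl i (R.refl j (u x)) = u (x + 2 * θ) := by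
    intro x
    have h3 : Real.sin (x + 2 * θ + θ) = 2 * Real.cos θ * Real.sin (x + 2 * θ)
        - Real.sin (x + θ) := by
      have := hrec (x + θ)
      rw [show x + 2 * θ + θ = x + θ + 2 * θ by ring, this]
      ring_nf
    simp only [u, map_add, map_smul, refl_root_self, refl_root, map_sub, map_neg, hG, hG', h3,
      hrec x]
    module
  have hun : ∀ (n : ℕ) x, ((R.refl i * R.refl j) ^ n) (u x) = u (x + n * (2 * θ)) := by
    intro n
    induction n with
    | zero => intro x; simp
    | succ n ih =>
      intro x
      rw [pow_succ, Module.End.mul_apply, Module.End.mul_apply, hu, ih]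
      congr 1; push_cast; ring
  have hum : ∀ x, ((R.refl i * R.refl j) ^ M i j) (u x) = u x := by
    intro x
    have : (M i j : ℝ) * (2 * θ) = 2 * Real.pi := by rw [hθ]; field_simp
    rw [hun, this]
    simp only [u]
    rw [Real.sin_add_two_pi, show x + 2 * Real.pi + θ = x + θ + 2 * Real.pi by ring,
      Real.sin_add_two_pi]
  have hi : ((R.refl i * R.refl j) ^ M i j) (R.root i) = R.root i := by
    have h := hum 0
    simp only [u, Real.sin_zero, zero_smul, zero_add, map_smul] at h
    exact smul_right_injective V hsin.ne' h
  have hj : ((R.refl i * R.refl j) ^ M i j) (R.root j) = R.root j := by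
    have h := hum (-θ)
    simp only [u, neg_add_cancel, Real.sin_zero, zero_smul, add_zero, map_smul, Real.sin_neg] at h
    exact smul_right_injective V (neg_ne_zero.2 hsin.ne') h
  have hfix : ∀ y, R.form (R.root i) y = 0 → R.form (R.root j) y = 0 →
      ∀ n, ((R.refl i * R.refl j) ^ n) y = y := by
    intro y h1 h2 n
    induction n with
    | zero => simp
    | succ n ih =>
      rw [pow_succ, Module.End.mul_apply, Module.End.mul_apply, R.refl_apply j, h2]
      simp only [mul_zero, zero_smul, sub_zero]
      rw [R.refl_apply i, h1]
      simpa using ih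
  ext x
  have hs2 : 1 - Real.cos θ ^ 2 ≠ 0 := by
    have := Real.sin_sq_add_cos_sq θ; nlinarith
  set p := R.form (R.root i) x
  set q := R.form (R.root j) x
  let a := (p + Real.cos θ * q) / (1 - Real.cos θ ^ 2)
  let b := (q + Real.cos θ * p) / (1 - Real.cos θ ^ 2)
  have h := hfix (x - (a • R.root i + b • R.root j))
    (by simp only [map_sub, map_add, map_smul, form_root_self, gram, hG, smul_eq_mul, a, b]
        change p - _ = 0
        field_simp; ring)
    (by simp only [map_sub, map_add, map_smul, form_root_self, gram, hG', smul_eq_mul, a, b]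
        change q - _ = 0
        field_simp; ring) (M i j)
  simp only [map_sub, map_add, map_smul, hi, hj] at h
  simpa using h

/-- The representation of a Coxeter group by reflections in the simple roots. -/
noncomputable def rep : W →* Module.End ℝ V := cs.lift ⟨R.refl, R.isLiftable⟩

@[simp] theorem rep_simple (i : B) : R.rep cs (cs.simple i) = R.refl i := by
  simp [rep]

theorem form_rep (w : W) (x y : V) :
    R.form (R.rep cs w x) (R.rep cs w y) = R.form x y := by
  induction w using cs.simple_induction_left with
  | one => simp
  | mul_simple_left w i ih => simp [form_refl, ih]

/-- Nonnegative combinations of the simple roots. -/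
def cone [Fintype B] : Set V := {x | ∃ c : B → ℝ, (∀ i, 0 ≤ c i) ∧ x = ∑ i, c i • R.root i}

theorem root_mem_cone [Fintype B] (i : B) : R.root i ∈ R.cone := by
  classical
  refine ⟨Pi.single i 1, fun j => ?_, by simp [Pi.single_apply]⟩
  by_cases h : j = i
  · subst h; simp
  · simp [h]

theorem smul_add_smul_mem_cone [Fintype B] {x y : V} (hx : x ∈ R.cone) (hy : y ∈ R.cone)
    {p q : ℝ} (hp : 0 ≤ p) (hq : 0 ≤ q) : p • x + q • y ∈ R.cone := by
  obtain ⟨c, hc, rfl⟩ := hx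
  obtain ⟨d, hd, rfl⟩ := hy
  refine ⟨fun i => p * c i + q * d i, fun i => ?_, ?_⟩
  · have := hc i; have := hd i; positivity
  · simp [Finset.smul_sum, add_smul, Finset.sum_add_distrib, smul_smul]

/-- The coefficients of the roots of a rank two root system. -/
noncomputable def dihedralCoeff (c : ℝ) : ℕ → ℝ
  | 0 => 0
  | 1 => 1
  | (k + 2) => 2 * c * dihedralCoeff c (k + 1) - dihedralCoeff c k

theorem dihedralCoeff_cos (θ : ℝ) (k : ℕ) :
    dihedralCoeff (Real.cos θ) k * Real.sin θ = Real.sin (k * θ) := by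
  induction k using Nat.twoStepInduction with
  | zero => simp [dihedralCoeff]
  | one => simp [dihedralCoeff]
  | more k ih1 ih2 =>
    have h1 : ((k + 2 : ℕ) : ℝ) * θ = ((k + 1 : ℕ) : ℝ) * θ + θ := by push_cast; ring
    have h2 : (k : ℝ) * θ = ((k + 1 : ℕ) : ℝ) * θ - θ := by push_cast; ring
    rw [dihedralCoeff, sub_mul, ih1, mul_assoc, ih2, h1, Real.sin_add, h2, Real.sin_sub]
    ring

theorem dihedralCoeff_one (k : ℕ) : dihedralCoeff 1 k = k := by
  induction k using Nat.twoStepInduction with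
  | zero => simp [dihedralCoeff]
  | one => simp [dihedralCoeff]
  | more k ih1 ih2 => rw [dihedralCoeff, ih1, ih2]; push_cast; ring

theorem dihedralCoeff_nonneg {i j : B} (hij : i ≠ j) (k : ℕ) (hk : M i j = 0 ∨ k ≤ M i j) :
    0 ≤ dihedralCoeff (-formEntry M i j) k := by
  by_cases h0 : M i j = 0
  · simp [formEntry, h0, dihedralCoeff_one]
  · have hk : k ≤ M i j := by tauto
    have hM : 2 ≤ M i j := by have := M.off_diagonal i j hij; omega
    have hM' : (2 : ℝ) ≤ M i j := by exact_mod_cast hM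
    have hk' : (k : ℝ) ≤ M i j := by exact_mod_cast hk
    have hπ := Real.pi_pos
    have hsin : 0 < Real.sin (Real.pi / M i j) := by
      apply Real.sin_pos_of_pos_of_lt_pi
      · positivity
      · rw [div_lt_iff₀ (by linarith)]; nlinarith
    have h1 : 0 ≤ Real.sin (k * (Real.pi / M i j)) := by
      apply Real.sin_nonneg_of_nonneg_of_le_pi
      · positivity
      · rw [mul_div_assoc', div_le_iff₀ (by linarith)]; nlinarith
    rw [← dihedralCoeff_cos] at h1
    simp only [formEntry, h0, if_false, neg_neg]
    exact nonneg_of_mul_nonneg_left h1 hsin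

theorem rep_alternatingWord_root (i j : B) (k : ℕ) :
    R.rep cs (cs.wordProd (CoxeterSystem.alternatingWord i j k)) (R.root i) =
      dihedralCoeff (-formEntry M i j) (k + 1) • R.root (if Even k then i else j) +
      dihedralCoeff (-formEntry M i j) k • R.root (if Even k then j else i) := by
  induction k with
  | zero => simp [CoxeterSystem.alternatingWord, dihedralCoeff]
  | succ k ih =>
    rw [CoxeterSystem.alternatingWord_succ', CoxeterSystem.wordProd_cons, map_mul,
      Module.End.mul_apply, ih, rep_simple, dihedralCoeff]
    have := formEntry_symm M i j
    by_cases hk : Even k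
    · have h1 : ¬ Even (k + 1) := by simp [hk, parity_simps]
      simp only [hk, h1, if_true, if_false, map_add, map_smul, refl_root, formEntry_self, ← this]
      module
    · have h1 : Even (k + 1) := by simp [hk, parity_simps]
      simp only [hk, h1, if_true, if_false, map_add, map_smul, refl_root, formEntry_self]
      module

theorem rep_root_mem_cone [Fintype B] (n : ℕ) : ∀ (w : W) (i : B), cs.length w = n →
    cs.length w < cs.length (w * cs.simple i) → R.rep cs w (R.root i) ∈ R.cone := by
  induction n using Nat.strong_induction_on with
  | _ n ih =>
  intro w i hn hi
  by_cases hw : w = 1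
  · subst hw; simpa using R.root_mem_cone i
  obtain ⟨j, hj⟩ := cs.exists_rightDescent_of_ne_one hw
  have hj' := cs.isRightDescent_iff.1 hj
  have hij : i ≠ j := by
    rintro rfl
    unfold CoxeterSystem.IsRightDescent at hj
    omega
  let d : ℕ → W := fun k => cs.wordProd (CoxeterSystem.alternatingWord i j k)
  let x : ℕ → B := fun k => if Even k then j else i
  have hd : ∀ k, d (k + 1) = cs.simple (x k) * d k := fun k => by
    simp only [d, x, CoxeterSystem.alternatingWord_succ', CoxeterSystem.wordProd_cons]
  let P : ℕ → Prop := fun k => cs.length (w * (d k)⁻¹) + k = cs.length w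
  have hP1 : P 1 := by
    simpa [P, d, CoxeterSystem.alternatingWord, CoxeterSystem.wordProd] using hj'
  have hPle : ∀ k, P k → k ≤ n := fun k hk => by simp only [P] at hk; omega
  classical
  obtain ⟨k, hk⟩ : ∃ k, k = Nat.findGreatest P n := ⟨_, rfl⟩
  have hk1 : 1 ≤ k := hk ▸ Nat.le_findGreatest (hPle 1 hP1) hP1
  have hPk : P k := hk ▸ Nat.findGreatest_spec (hPle 1 hP1) hP1
  have hstep : ∀ l, w * (d (l + 1))⁻¹ = w * (d l)⁻¹ * cs.simple (x l) := fun l => by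
    rw [hd, mul_inv_rev, cs.inv_simple, mul_assoc]
  set w' := w * (d k)⁻¹ with hw'
  have hw'd : w = w' * d k := by simp [hw']
  have hlen : cs.length w' + k = n := by rw [← hn]; exact hPk
  have hup1 : cs.length w' < cs.length (w' * cs.simple (x k)) := by
    rcases cs.length_mul_simple w' (x k) with h | h
    · omega
    · exfalso
      have hP : P (k + 1) := by
        simp only [P]
        rw [hstep, ← hw']; omega
      have := Nat.le_findGreatest (hPle _ hP) hP
      omega
  have hup2 : cs.length w' < cs.length (w' * cs.simple (x (k - 1))) := by
    obtain ⟨l, hl⟩ : ∃ l, k = l + 1 := ⟨k - 1, by omega⟩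
    have h1 : w' * cs.simple (x l) = w * (d l)⁻¹ := by
      rw [hw', hl, hstep, cs.simple_mul_simple_cancel_right]
    rw [hl, Nat.add_sub_cancel, h1]
    have h2 : cs.length w ≤ cs.length (w * (d l)⁻¹) + cs.length (d l) := by
      conv_lhs => rw [show w = w * (d l)⁻¹ * d l by simp]
      exact cs.length_mul_le _ _
    have h3 : cs.length (d l) ≤ l := by
      simpa using cs.length_wordProd_le (CoxeterSystem.alternatingWord i j l)
    omega
  have hi' : R.rep cs w' (R.root i) ∈ R.cone ∧ R.rep cs w' (R.root j) ∈ R.cone := by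
    have e1 := ih _ (by omega) w' (x k) rfl hup1
    have e2 := ih _ (by omega) w' (x (k - 1)) rfl hup2
    obtain ⟨l, hl⟩ : ∃ l, k = l + 1 := ⟨k - 1, by omega⟩
    rw [hl] at e1 e2
    rw [Nat.add_sub_cancel] at e2
    simp only [x] at e1 e2
    by_cases h : Even l
    · have h1 : ¬ Even (l + 1) := by simp [h, parity_simps]
      simp only [h, h1, if_true, if_false] at e1 e2
      exact ⟨e1, e2⟩
    · have h1 : Even (l + 1) := by simp [h, parity_simps]
      simp only [h, h1, if_true, if_false] at e1 e2
      exact ⟨e2, e1⟩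
  have hkM : M i j = 0 ∨ k + 1 ≤ M i j := by
    by_contra! hcon
    obtain ⟨hM0, hMk⟩ := hcon
    obtain ⟨l, hl⟩ : ∃ l, k = l + M i j := ⟨k - M i j, by omega⟩
    have hsplit : ∀ l, ∃ v : W, cs.length v ≤ l ∧
        d (l + M i j) = v * cs.wordProd (CoxeterSystem.braidWord M i j) := by
      intro l
      induction l with
      | zero => exact ⟨1, by simp, by simp [d, CoxeterSystem.braidWord]⟩
      | succ l ih =>
        obtain ⟨v, hv, hv'⟩ := ih
        refine ⟨cs.simple (x (l + M i j)) * v, ?_, ?_⟩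
        · have := cs.length_mul_le (cs.simple (x (l + M i j))) v
          rw [cs.length_simple] at this
          omega
        · rw [show l + 1 + M i j = (l + M i j) + 1 by ring, hd, hv', mul_assoc]
    obtain ⟨v, hv, hv'⟩ := hsplit l
    obtain ⟨m, hm⟩ : ∃ m, M i j = m + 1 := ⟨M i j - 1, by omega⟩
    have hb : cs.wordProd (CoxeterSystem.braidWord M i j) * cs.simple i =
        cs.wordProd (CoxeterSystem.alternatingWord i j m) := by
      rw [cs.wordProd_braidWord_eq, CoxeterSystem.braidWord, M.symmetric j i, hm,
        CoxeterSystem.alternatingWord_succ, cs.wordProd_concat,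
        cs.simple_mul_simple_cancel_right]
    have hws : w * cs.simple i =
        w' * (v * cs.wordProd (CoxeterSystem.alternatingWord i j m)) := by
      rw [← hb, hw'd, hl, hv']; simp only [mul_assoc]
    have h1 := cs.length_mul_le w' (v * cs.wordProd (CoxeterSystem.alternatingWord i j m))
    have h2 := cs.length_mul_le v (cs.wordProd (CoxeterSystem.alternatingWord i j m))
    have h3 := cs.length_wordProd_le (CoxeterSystem.alternatingWord i j m)
    rw [CoxeterSystem.length_alternatingWord] at h3
    rw [hws] at hi
    omega
  rw [hw'd, map_mul, Module.End.mul_apply]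
  simp only [d]
  rw [rep_alternatingWord_root, map_add, map_smul, map_smul]
  apply R.smul_add_smul_mem_cone
  · split_ifs
    exacts [hi'.1, hi'.2]
  · split_ifs
    exacts [hi'.2, hi'.1]
  · exact dihedralCoeff_nonneg hij _ hkM
  · exact dihedralCoeff_nonneg hij _ (by omega)

section Timelike

variable [Fintype B] {R} {v : V}

theorem form_le_of_mem_cone {ε : ℝ} (hε : ∀ i, R.form (R.root i) v ≤ -ε) (hε0 : 0 < ε) {y : V}
    (hy : y ∈ R.cone) (h1 : R.form y y = 1) : R.form y v ≤ -ε := by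
  obtain ⟨c, hc, rfl⟩ := hy
  have hle : (1 : ℝ) ≤ (∑ i, c i) * ∑ j, c j := by
    rw [← h1, Finset.sum_mul_sum]
    simp only [map_sum, map_smul, LinearMap.sum_apply, LinearMap.smul_apply, smul_eq_mul, R.gram]
    refine Finset.sum_le_sum fun i _ => ?_
    rw [Finset.mul_sum]
    refine Finset.sum_le_sum fun j _ => ?_
    linarith [mul_le_mul_of_nonneg_left (formEntry_le_one M j i) (mul_nonneg (hc i) (hc j))]
  have hs : 0 ≤ ∑ i, c i := Finset.sum_nonneg fun i _ => hc i
  have hs1 : 1 ≤ ∑ i, c i := by nlinarith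
  simp only [map_sum, map_smul, LinearMap.sum_apply, LinearMap.smul_apply, smul_eq_mul]
  calc ∑ i, c i * R.form (R.root i) v ≤ ∑ i, c i * (-ε) :=
        Finset.sum_le_sum fun i _ => mul_le_mul_of_nonneg_left (hε i) (hc i)
    _ = -(∑ i, c i) * ε := by rw [← Finset.sum_mul]; ring
    _ ≤ -ε := by nlinarith

theorem exists_form_rep_le (hv : ∀ i, R.form (R.root i) v < 0) :
    ∃ δ : ℝ, 0 < δ ∧ ∀ w, R.form (R.rep cs w v) v ≤ R.form v v - δ * cs.length w := by
  obtain ⟨ε, hε0, hε⟩ : ∃ ε : ℝ, 0 < ε ∧ ∀ i, R.form (R.root i) v ≤ -ε := by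
    cases isEmpty_or_nonempty B
    · exact ⟨1, one_pos, fun i => isEmptyElim i⟩
    · obtain ⟨i, hi⟩ := Finite.exists_max fun i => R.form (R.root i) v
      exact ⟨-R.form (R.root i) v, by linarith [hv i], fun j => by linarith [hi j]⟩
  refine ⟨2 * ε * ε, by positivity, fun w => ?_⟩
  induction hn : cs.length w generalizing w with
  | zero =>
    rw [cs.length_eq_zero_iff.1 hn]; simp
  | succ n ih =>
    have hw : w ≠ 1 := by rintro rfl; simp at hn
    obtain ⟨i, hi⟩ := cs.exists_rightDescent_of_ne_one hw
    have hi' := cs.isRightDescent_iff.1 hi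
    set u := w * cs.simple i with hu
    have hwu : w = u * cs.simple i := by simp [hu]
    have hroot := R.rep_root_mem_cone cs _ u i rfl (by rw [← hwu]; omega)
    have h1 := form_le_of_mem_cone hε hε0 hroot (by rw [form_rep, form_root_self])
    have h2 := ih u (by omega)
    rw [hwu, map_mul, Module.End.mul_apply, rep_simple, refl_apply, map_sub, map_smul,
      LinearMap.map_sub₂, LinearMap.map_smul₂, smul_eq_mul]
    have h3 := hε i
    push_cast
    nlinarith [mul_nonneg (by linarith : 0 ≤ -ε - R.form (R.root i) v)
      (by linarith : 0 ≤ -R.form (R.rep cs u (R.root i)) v)]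

theorem form_rep_lt (hv : ∀ i, R.form (R.root i) v < 0) {w : W} (hw : w ≠ 1) :
    R.form (R.rep cs w v) v < R.form v v := by
  obtain ⟨δ, hδ, h⟩ := R.exists_form_rep_le cs hv
  have h1 := h w
  have h2 : (0 : ℝ) < cs.length w := by
    have : cs.length w ≠ 0 := fun h => hw (cs.length_eq_zero_iff.1 h)
    exact_mod_cast Nat.pos_of_ne_zero this
  nlinarith [mul_pos hδ h2]

theorem form_self_neg [Nonempty B] (hv : ∀ i, R.form (R.root i) v < 0) (hvc : v ∈ R.cone) :
    R.form v v < 0 := by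
  obtain ⟨c, hc, hcv⟩ := hvc
  have hsum : R.form v v = ∑ i, c i * R.form (R.root i) v := by
    have h : R.form (∑ i, c i • R.root i) v = ∑ i, c i * R.form (R.root i) v := by simp
    rwa [← hcv] at h
  have hle : ∀ i ∈ Finset.univ, c i * R.form (R.root i) v ≤ 0 := fun i _ =>
    mul_nonpos_of_nonneg_of_nonpos (hc i) (hv i).le
  rw [hsum]
  refine lt_of_le_of_ne (Finset.sum_nonpos hle) fun h0 => ?_
  have h := (Finset.sum_eq_zero_iff_of_nonpos hle).1 h0
  have hc0 : ∀ i, c i = 0 := fun i =>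
    (mul_eq_zero.1 (h i (Finset.mem_univ i))).resolve_right (hv i).ne
  have hv0 : v = 0 := by rw [hcv]; simp [hc0]
  have := hv (Classical.arbitrary B)
  simp [hv0] at this

theorem exists_lt_length [Infinite W] (n : ℕ) : ∃ w, n < cs.length w := by
  by_contra! h
  refine Set.infinite_univ (α := W) (((List.finite_length_le B n).image cs.wordProd).subset ?_)
  intro w _
  obtain ⟨ω, hω, rfl⟩ := cs.exists_isReduced w
  exact ⟨ω, by have := h (cs.wordProd ω); rw [hω.eq] at this; exact this, rfl⟩

theorem exists_form_root_lt [Infinite W] (hv : ∀ i, R.form (R.root i) v < 0)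
    (hvc : v ∈ R.cone) : ∃ w i j, R.form (R.rep cs w (R.root i)) (R.root j) < -1 := by
  by_contra! hcon
  obtain ⟨δ, hδ, h⟩ := R.exists_form_rep_le cs hv
  obtain ⟨c, hc, hcv⟩ := hvc
  have hbd : ∀ w, -((∑ i, c i) * ∑ j, c j) ≤ R.form (R.rep cs w v) v := by
    intro w
    rw [hcv, Finset.sum_mul_sum, ← Finset.sum_neg_distrib]
    simp only [map_sum, map_smul, LinearMap.sum_apply, LinearMap.smul_apply, smul_eq_mul]
    refine Finset.sum_le_sum fun i _ => ?_
    rw [← Finset.sum_neg_distrib, Finset.mul_sum]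
    refine Finset.sum_le_sum fun j _ => ?_
    nlinarith [hcon w j i, mul_nonneg (hc i) (hc j)]
  obtain ⟨n, hn⟩ := exists_nat_gt ((R.form v v + (∑ i, c i) * ∑ j, c j) / δ)
  obtain ⟨w, hw⟩ := exists_lt_length cs n
  have h1 := h w
  have h2 := hbd w
  have h3 : (n : ℝ) < cs.length w := by exact_mod_cast hw
  rw [div_lt_iff₀ hδ] at hn
  nlinarith

end Timelike

end RootSpace

/-- `T` is an isometry which acts on the hyperbolic plane spanned by the isotropic vectors `p`, `q`
with eigenvalues `ν > 1` and `ν⁻¹`, and fixes the orthogonal complement of that plane. -/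
structure IsAxis {V : Type*} [AddCommGroup V] [Module ℝ V] (b : V →ₗ[ℝ] V →ₗ[ℝ] ℝ)
    (T : Module.End ℝ V) (ν : ℝ) (p q : V) : Prop where
  isom : ∀ x y, b (T x) (T y) = b x y
  one_lt : 1 < ν
  left : T p = ν • p
  right : T q = ν⁻¹ • q
  ne : b p q ≠ 0
  fix : ∀ x, b x p = 0 → b x q = 0 → T x = x

namespace IsAxis

variable {V : Type*} [AddCommGroup V] [Module ℝ V] {b : V →ₗ[ℝ] V →ₗ[ℝ] ℝ}
  {T : Module.End ℝ V} {ν : ℝ} {p q : V}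

theorem left_left (h : IsAxis b T ν p q) : b p p = 0 := by
  have h1 := h.isom p p
  have := h.one_lt
  simp only [h.left, map_smul, LinearMap.smul_apply, smul_eq_mul] at h1
  have h2 : (ν * ν - 1) * b p p = 0 := by linarith
  exact (mul_eq_zero.1 h2).resolve_left (by nlinarith)

theorem right_right (h : IsAxis b T ν p q) : b q q = 0 := by
  have h1 := h.isom q q
  have := h.one_lt
  simp only [h.right, map_smul, LinearMap.smul_apply, smul_eq_mul] at h1
  have h2 : (ν * ν - 1) * b q q = 0 := by field_simp at h1; linarith
  exact (mul_eq_zero.1 h2).resolve_left (by nlinarith)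

theorem left_ne_zero (h : IsAxis b T ν p q) : p ≠ 0 := fun h0 => h.ne (by simp [h0])

theorem right_ne_zero (h : IsAxis b T ν p q) : q ≠ 0 := fun h0 => h.ne (by simp [h0])

variable (hb : ∀ x y, b x y = b y x)
include hb

theorem fix_sub (h : IsAxis b T ν p q) (x : V) :
    T (x - (b x q / b p q) • p - (b x p / b p q) • q) =
      x - (b x q / b p q) • p - (b x p / b p q) • q := by
  apply h.fix <;>
  simp only [LinearMap.map_sub₂, LinearMap.map_smul₂, smul_eq_mul, h.left_left, h.right_right,
    hb q p] <;>
  field_simp [h.ne] <;> ring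

theorem eq_smul_left (h : IsAxis b T ν p q) {x : V} (hx : T x = ν • x) :
    x = (b x q / b p q) • p := by
  have h1 := h.isom x p
  have hν := h.one_lt
  simp only [hx, h.left, map_smul, LinearMap.smul_apply, smul_eq_mul] at h1
  have h2 : b x p = 0 := by
    have h2 : (ν * ν - 1) * b x p = 0 := by linarith
    exact (mul_eq_zero.1 h2).resolve_left (by nlinarith)
  have h3 := h.fix_sub hb x
  simp only [h2, zero_div, zero_smul, sub_zero, map_sub, map_smul, hx, h.left] at h3
  have h4 : (ν - 1) • (x - (b x q / b p q) • p) = 0 := by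
    rw [sub_smul, one_smul]
    nth_rewrite 2 [← h3]
    module
  exact sub_eq_zero.1 ((smul_eq_zero.1 h4).resolve_left (by linarith))

theorem eq_smul_right (h : IsAxis b T ν p q) {x : V} (hx : T x = ν⁻¹ • x) :
    x = (b x p / b p q) • q := by
  have h1 := h.isom x q
  have hν := h.one_lt
  simp only [hx, h.right, map_smul, LinearMap.smul_apply, smul_eq_mul] at h1
  have h2 : b x q = 0 := by
    have h2 : (ν * ν - 1) * b x q = 0 := by field_simp at h1; linarith
    exact (mul_eq_zero.1 h2).resolve_left (by nlinarith)
  have h3 := h.fix_sub hb x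
  simp only [h2, zero_div, zero_smul, sub_zero, map_sub, map_smul, hx, h.right] at h3
  have h4 : (ν⁻¹ - 1) • (x - (b x p / b p q) • q) = 0 := by
    rw [sub_smul, one_smul]
    nth_rewrite 2 [← h3]
    module
  have h5 : ν⁻¹ - 1 ≠ 0 := by
    have := inv_lt_one_of_one_lt₀ hν
    linarith
  exact sub_eq_zero.1 ((smul_eq_zero.1 h4).resolve_left h5)

theorem eq_smul_left_of_eigen (h : IsAxis b T ν p q) {x : V} {c : ℝ} (hx : T x = c • x)
    (hq : b x q ≠ 0) : x = (b x q / b p q) • p := by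
  have h1 := h.isom x q
  have hν := h.one_lt
  simp only [hx, h.right, map_smul, LinearMap.smul_apply, smul_eq_mul] at h1
  apply h.eq_smul_left hb
  rw [hx]
  congr 1
  field_simp at h1
  exact h1

theorem eq_smul_right_of_eigen (h : IsAxis b T ν p q) {x : V} {c : ℝ} (hx : T x = c • x)
    (hp : b x p ≠ 0) : x = (b x p / b p q) • q := by
  have h1 := h.isom x p
  have hν := h.one_lt
  simp only [hx, h.left, map_smul, LinearMap.smul_apply, smul_eq_mul] at h1
  apply h.eq_smul_right hb
  rw [hx]
  congr 1
  field_simp at h1 ⊢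
  linarith

theorem pow_apply (h : IsAxis b T ν p q) (n : ℕ) (x : V) :
    (T ^ n) x = (ν ^ n * (b x q / b p q)) • p + (ν⁻¹ ^ n * (b x p / b p q)) • q +
      (x - (b x q / b p q) • p - (b x p / b p q) • q) := by
  induction n with
  | zero => simp
  | succ n ih =>
    rw [pow_succ', Module.End.mul_apply, ih, map_add, h.fix_sub hb, map_add, map_smul, map_smul,
      h.left, h.right, pow_succ, pow_succ]
    module

theorem functional_left_nonpos (h : IsAxis b T ν p q) (φ : V →ₗ[ℝ] ℝ) {x : V}
    (hφ : ∀ n : ℕ, φ ((T ^ n) x) ≤ 0) : φ ((b x q / b p q) • p) ≤ 0 := by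
  by_contra! hcon
  have hν := h.one_lt
  set P := φ ((b x q / b p q) • p) with hP
  set Q := φ ((b x p / b p q) • q) with hQ
  obtain ⟨n, hn⟩ := pow_unbounded_of_one_lt ((|Q| + |φ x - P - Q|) / P) hν
  have h1 := hφ n
  rw [h.pow_apply hb, map_add, map_add, mul_smul, mul_smul, map_smul φ (ν ^ n),
    map_smul φ (ν⁻¹ ^ n), map_sub, map_sub, ← hP, ← hQ, smul_eq_mul, smul_eq_mul] at h1
  rw [div_lt_iff₀ hcon] at hn
  have h2 : 0 ≤ ν⁻¹ ^ n := by positivity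
  have h3 : ν⁻¹ ^ n ≤ 1 := pow_le_one₀ (by positivity) (inv_le_one_of_one_le₀ hν.le)
  have h4 : -|Q| ≤ ν⁻¹ ^ n * Q := by
    have := neg_abs_le (ν⁻¹ ^ n * Q)
    rw [abs_mul, abs_of_nonneg h2] at this
    nlinarith [abs_nonneg Q]
  linarith [neg_abs_le (φ x - P - Q)]

end IsAxis

namespace IsAxis

variable {V : Type*} [AddCommGroup V] [Module ℝ V] {b : V →ₗ[ℝ] V →ₗ[ℝ] ℝ}
  {T T' : Module.End ℝ V} {ν : ℝ} {p q : V}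

theorem swap (hb : ∀ x y, b x y = b y x) (h : IsAxis b T ν p q) (h1 : ∀ x, T (T' x) = x)
    (h2 : ∀ x, T' (T x) = x) : IsAxis b T' ν q p where
  isom x y := by rw [← h.isom, h1, h1]
  one_lt := h.one_lt
  left := by
    have hν : ν ≠ 0 := by linarith [h.one_lt]
    have h3 := h2 q
    rw [h.right, map_smul] at h3
    rw [← h3, smul_smul, mul_inv_cancel₀ hν, one_smul, h3]
  right := by
    have hν : ν ≠ 0 := by linarith [h.one_lt]
    have h3 := h2 p
    rw [h.left, map_smul] at h3
    rw [← h3, smul_smul, inv_mul_cancel₀ hν, one_smul, h3]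
  ne := by rw [hb]; exact h.ne
  fix x hq hp := by
    rw [← h.fix x hp hq, h2, h.fix x hp hq]

theorem smul (h : IsAxis b T ν p q) {s t : ℝ} (hs : s ≠ 0) (ht : t ≠ 0) :
    IsAxis b T ν (s • p) (t • q) where
  isom := h.isom
  one_lt := h.one_lt
  left := by rw [map_smul, h.left, smul_comm]
  right := by rw [map_smul, h.right, smul_comm]
  ne := by simp [hs, ht, h.ne]
  fix x hp hq := h.fix x (by simpa [hs] using hp) (by simpa [ht] using hq)

theorem pow (h : IsAxis b T ν p q) {n : ℕ} (hn : n ≠ 0) : IsAxis b (T ^ n) (ν ^ n) p q where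
  isom x y := by
    clear hn
    induction n with
    | zero => rfl
    | succ n ih => rw [pow_succ', Module.End.mul_apply, Module.End.mul_apply, h.isom, ih]
  one_lt := one_lt_pow₀ h.one_lt hn
  left := by
    clear hn
    induction n with
    | zero => simp
    | succ n ih => rw [pow_succ', Module.End.mul_apply, ih, map_smul, h.left, smul_smul, pow_succ]
  right := by
    clear hn
    induction n with
    | zero => simp
    | succ n ih =>
      rw [pow_succ', Module.End.mul_apply, ih, map_smul, h.right, smul_smul, pow_succ, mul_inv]
  ne := h.ne
  fix x hp hq := by
    clear hn
    induction n with
    | zero => rfl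
    | succ n ih => rw [pow_succ', Module.End.mul_apply, ih, h.fix x hp hq]

end IsAxis

namespace RootSpace

variable {B W V : Type*} [Group W] {M : CoxeterMatrix B} [AddCommGroup V] [Module ℝ V]
  {R : RootSpace M V} (cs : CoxeterSystem M W) {v : V}

theorem rep_rep_inv (w : W) (x : V) : R.rep cs w (R.rep cs w⁻¹ x) = x := by
  rw [← Module.End.mul_apply, ← map_mul, mul_inv_cancel, map_one, Module.End.one_apply]

theorem rep_inv_rep (w : W) (x : V) : R.rep cs w⁻¹ (R.rep cs w x) = x := by
  rw [← Module.End.mul_apply, ← map_mul, inv_mul_cancel, map_one, Module.End.one_apply]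

theorem rep_mul_apply (w w' : W) (x : V) : R.rep cs (w * w') x = R.rep cs w (R.rep cs w' x) := by
  rw [map_mul, Module.End.mul_apply]

theorem form_rep_left (w : W) (x y : V) :
    R.form (R.rep cs w x) y = R.form x (R.rep cs w⁻¹ y) := by
  rw [← R.form_rep cs w⁻¹, rep_inv_rep]

theorem exists_isAxis_of_lt {w : W} {i j : B}
    (h : R.form (R.rep cs w (R.root i)) (R.root j) < -1) :
    ∃ g ν p q, IsAxis R.form (R.rep cs g) ν p q := by
  obtain ⟨τ, hτ⟩ : ∃ τ, τ = -R.form (R.rep cs w (R.root i)) (R.root j) := ⟨_, rfl⟩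
  have hτ1 : 1 < τ := by linarith
  set α := R.rep cs w (R.root i) with hα
  set β := R.root j with hβ
  have hαβ : R.form α β = -τ := by linarith
  have hβα : R.form β α = -τ := by rw [R.symm, hαβ]
  have hαα : R.form α α = 1 := by rw [hα, form_rep, form_root_self]
  have hββ : R.form β β = 1 := R.form_root_self j
  have hs := Real.sq_sqrt (show 0 ≤ τ ^ 2 - 1 by nlinarith)
  have hs0 : 0 < √(τ ^ 2 - 1) := Real.sqrt_pos.2 (by nlinarith)
  obtain ⟨c, d, hcd, hsum, hd⟩ : ∃ c d : ℝ, c * d = 1 ∧ c + d = 2 * τ ∧ 1 < d :=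
    ⟨τ - √(τ ^ 2 - 1), τ + √(τ ^ 2 - 1), by linarith, by ring, by linarith⟩
  have hact : ∀ x, R.rep cs (w * cs.simple i * w⁻¹ * cs.simple j) x =
      x - (2 * R.form β x) • β - (2 * R.form α (x - (2 * R.form β x) • β)) • α := by
    intro x
    rw [rep_mul_apply, rep_mul_apply, rep_mul_apply, rep_simple, rep_simple, refl_apply _ j,
      refl_apply, map_sub, rep_rep_inv, map_smul, ← form_rep_left]
  have hc : c = d⁻¹ := eq_inv_of_mul_eq_one_left hcd
  have hd0 : d ≠ 0 := by linarith
  have key : ∀ c d : ℝ, c * d = 1 → c + d = 2 * τ →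
      R.rep cs (w * cs.simple i * w⁻¹ * cs.simple j) (α + c • β) = d ^ 2 • (α + c • β) := by
    intro c d hcd hsum
    have e1 : 2 * R.form β (α + c • β) = c - d := by
      simp only [map_add, map_smul, smul_eq_mul, hβα, hββ]; linarith
    have e2 : 2 * R.form α (α + c • β - (c - d) • β) = 1 - d ^ 2 := by
      simp only [map_add, map_sub, map_smul, smul_eq_mul, hαα, hαβ]
      linear_combination d * hsum - hcd
    have e3 : d ^ 2 * c = d := by linear_combination d * hcd
    rw [hact, e1, e2, smul_add, smul_smul, e3]
    module
  refine ⟨w * cs.simple i * w⁻¹ * cs.simple j, d ^ 2, α + c • β, α + d • β,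
    R.form_rep cs _, one_lt_pow₀ hd two_ne_zero, key c d hcd hsum, ?_, ?_, ?_⟩
  · rw [key d c (by linarith) (by linarith), hc, inv_pow]
  · simp only [map_add, map_smul, LinearMap.add_apply, LinearMap.smul_apply, smul_eq_mul, hαα, hαβ,
      hβα, hββ]
    have : 1 + d * -τ + (c * (-τ + d * 1)) = 2 - 2 * τ ^ 2 := by
      linear_combination (-τ) * hsum + hcd
    nlinarith
  · intro x hp hq
    simp only [map_add, map_smul, smul_eq_mul] at hp hq
    have h1 : (d - c) * R.form x β = 0 := by linarith
    have hdc : d - c ≠ 0 := by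
      have := inv_lt_one_of_one_lt₀ hd
      linarith
    have h2 : R.form x β = 0 := (mul_eq_zero.1 h1).resolve_left hdc
    have h3 : R.form x α = 0 := by rw [h2] at hp; linarith
    rw [hact, R.symm β, h2]
    simp [R.symm α, h3]

variable [Fintype B]

/-- A root space with a nondegenerate form on which the group acts irreducibly, together with a
vector `v` in the cone of the simple roots which has negative product with all simple roots. -/
structure IsHyperbolic (R : RootSpace M V) (v : V) : Prop where
  nondegenerate : ∀ x, (∀ y, R.form x y = 0) → x = 0
  eq_top : ∀ U : Submodule ℝ V, U ≠ ⊥ → (∀ i, ∀ x ∈ U, R.refl i x ∈ U) → U = ⊤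
  mem_cone : v ∈ R.cone
  form_root_neg : ∀ i, R.form (R.root i) v < 0

namespace IsHyperbolic

variable (hR : R.IsHyperbolic v)
include hR

theorem eq_top_of_rep {U : Submodule ℝ V} (hU : U ≠ ⊥)
    (h : ∀ w, ∀ x ∈ U, R.rep cs w x ∈ U) : U = ⊤ :=
  hR.eq_top U hU fun i x hx => by simpa using h (cs.simple i) x hx

theorem form_rep_rep_neg [Nonempty B] (w w' : W) :
    R.form (R.rep cs w v) (R.rep cs w' v) < 0 := by
  have h0 := form_self_neg hR.form_root_neg hR.mem_cone
  rw [R.symm, form_rep_left, ← rep_mul_apply, R.symm]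
  by_cases h : w'⁻¹ * w = 1
  · simpa [h] using h0
  · exact (form_rep_lt cs hR.form_root_neg h).trans h0

theorem exists_form_rep_ne_zero {x y : V} (hx : x ≠ 0) (hy : y ≠ 0) :
    ∃ w, R.form (R.rep cs w x) y ≠ 0 := by
  by_contra! h
  let U : Submodule ℝ V := ⨅ w, LinearMap.ker (R.form (R.rep cs w x))
  have hU : U = ⊤ := by
    refine hR.eq_top_of_rep cs (fun h0 => hy ?_) fun w z hz => ?_
    · rw [← Submodule.mem_bot ℝ, ← h0]
      simpa [U] using h
    · simp only [U, Submodule.mem_iInf, LinearMap.mem_ker] at hz ⊢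
      intro w'
      rw [R.symm, form_rep_left, ← rep_mul_apply, R.symm]
      exact hz _
  refine hx (hR.nondegenerate x fun z => ?_)
  have hz : z ∈ U := hU ▸ Submodule.mem_top
  simp only [U, Submodule.mem_iInf, LinearMap.mem_ker] at hz
  simpa using hz 1

theorem ne_zero [Nonempty B] : v ≠ 0 := by
  rintro rfl
  simpa using hR.form_root_neg (Classical.arbitrary B)

/-- The isotropic vectors of the axis of `g` may be chosen in the closed convex cone generated by
the orbit of `v`, on which the form is nonpositive. -/
theorem exists_oriented [Nonempty B] {g : W} {ν : ℝ} {p q : V}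
    (h : IsAxis R.form (R.rep cs g) ν p q) :
    ∃ p' q', IsAxis R.form (R.rep cs g) ν p' q' ∧ (∀ w, R.form (R.rep cs w p') p' ≤ 0) ∧
      (∀ w, R.form (R.rep cs w p') q' ≤ 0) ∧ ∀ w, R.form (R.rep cs w q') q' ≤ 0 := by
  let C : Set V := {x | ∀ φ : V →ₗ[ℝ] ℝ, (∀ w, φ (R.rep cs w v) ≤ 0) → φ x ≤ 0}
  have hC : ∀ x ∈ C, ∀ y ∈ C, ∀ w, R.form (R.rep cs w x) y ≤ 0 := by
    intro x hx y hy w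
    refine hy _ fun u => ?_
    refine hx ((R.form.flip (R.rep cs u v)) ∘ₗ R.rep cs w) fun u' => ?_
    simp only [LinearMap.comp_apply, LinearMap.flip_apply, ← rep_mul_apply]
    exact (hR.form_rep_rep_neg cs _ _).le
  have key : ∀ {g : W} {p q : V}, IsAxis R.form (R.rep cs g) ν p q → ∃ t : ℝ, t ≠ 0 ∧ t • p ∈ C := by
    intro g p q h
    obtain ⟨w, hw⟩ := hR.exists_form_rep_ne_zero cs hR.ne_zero h.right_ne_zero
    refine ⟨_, div_ne_zero hw h.ne, fun φ hφ => h.functional_left_nonpos R.symm φ fun n => ?_⟩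
    rw [← map_pow, ← rep_mul_apply]
    exact hφ _
  obtain ⟨s, hs, hsp⟩ := key h
  obtain ⟨t, ht, htq⟩ := key (h.swap R.symm (rep_rep_inv cs g) (rep_inv_rep cs g))
  exact ⟨s • p, t • q, h.smul hs ht, hC _ hsp _ hsp, hC _ hsp _ htq, hC _ htq _ htq⟩

theorem exists_isAxis_mem [Infinite W] (N : Subgroup W) [N.FiniteIndex] :
    ∃ g ∈ N, ∃ ν p q, IsAxis R.form (R.rep cs g) ν p q := by
  obtain ⟨w, i, j, h⟩ := exists_form_root_lt cs hR.form_root_neg hR.mem_cone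
  obtain ⟨g, ν, p, q, hg⟩ := exists_isAxis_of_lt cs h
  obtain ⟨n, hn, -, hgn⟩ := Subgroup.exists_pow_mem_of_index_ne_zero
    (Subgroup.FiniteIndex.index_ne_zero (H := N)) g
  exact ⟨g ^ n, hgn, ν ^ n, p, q, map_pow (R.rep cs) g n ▸ hg.pow hn.ne'⟩

end IsHyperbolic

end RootSpace

namespace RootSpace.IsHyperbolic

variable {B W V : Type*} [Fintype B] [Group W] {M : CoxeterMatrix B} [AddCommGroup V] [Module ℝ V]
  {R : RootSpace M V} {cs : CoxeterSystem M W} {v : V} (hR : R.IsHyperbolic v)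
include hR

omit hR in
theorem card_le_two_of_span_eq_top {p q : V} (hpp : R.form p p = 0) (hqq : R.form q q = 0)
    (hpq : R.form p q < 0) (h : Submodule.span ℝ {p, q} = ⊤) : Fintype.card B ≤ 2 := by
  have hspan : ∀ i, ∃ c d : ℝ, c • p + d • q = R.root i := fun i =>
    Submodule.mem_span_pair.1 (h ▸ Submodule.mem_top)
  choose c d hcd using hspan
  have hform : ∀ i j, R.form (R.root i) (R.root j) = (c i * d j + d i * c j) * R.form p q := by
    intro i j
    rw [← hcd i, ← hcd j]
    simp only [map_add, map_smul, LinearMap.add_apply, LinearMap.smul_apply, smul_eq_mul, hpp, hqq,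
      R.symm q p]
    ring
  have hneg : ∀ i, c i * d i < 0 := by
    intro i
    have := hform i i
    rw [form_root_self] at this
    nlinarith
  by_contra! hcard
  obtain ⟨i, j, hij, hsign⟩ := Fintype.exists_ne_map_eq_of_card_lt
    (fun i => decide (0 < c i)) (by simpa using hcard)
  have h1 := hform i j
  have h2 := formEntry_nonpos M hij
  rw [R.gram] at h1
  simp only [decide_eq_decide] at hsign
  have h3 : 0 ≤ c i * d j + d i * c j := by
    by_contra! h4
    nlinarith
  rcases lt_or_ge 0 (c i) with hi | hi
  · have hj := hsign.1 hi
    have hdi : d i < 0 := by nlinarith [hneg i]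
    have hdj : d j < 0 := by nlinarith [hneg j]
    nlinarith
  · have hj : c j ≤ 0 := not_lt.1 fun h => hi.not_gt (hsign.2 h)
    have hdi : 0 < d i := by nlinarith [hneg i]
    have hdj : 0 < d j := by nlinarith [hneg j]
    have hi' : c i < 0 := lt_of_le_of_ne hi fun h0 => by simpa [h0] using hneg i
    nlinarith

/-- A normal subgroup containing an element with an axis has no common eigenvector. -/
theorem eq_zero_of_forall_mem_eigen (hB : 2 < Fintype.card B) {N : Subgroup W} [hN : N.Normal]
    {g : W} (hg : g ∈ N) {ν : ℝ} {p q : V} (h : IsAxis R.form (R.rep cs g) ν p q)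
    (hpq : R.form p q < 0) {x : V} (hx : ∀ n ∈ N, ∃ c : ℝ, R.rep cs n x = c • x) : x = 0 := by
  by_contra hx0
  let P : V → Prop := fun y => ∀ n ∈ N, ∃ c : ℝ, R.rep cs n y = c • y
  have hPW : ∀ w y, P y → P (R.rep cs w y) := by
    intro w y hy n hn
    obtain ⟨c, hc⟩ := hy (w⁻¹ * n * w) (by simpa using hN.conj_mem n hn w⁻¹)
    refine ⟨c, ?_⟩
    rw [← map_smul, ← hc, ← rep_mul_apply, ← rep_mul_apply]
    congr 2
    group
  have hPs : ∀ (t : ℝ) y, t ≠ 0 → P (t • y) → P y := by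
    intro t y ht hy n hn
    obtain ⟨c, hc⟩ := hy n hn
    refine ⟨c, ?_⟩
    rw [map_smul, smul_comm] at hc
    exact smul_right_injective V ht hc
  have hPl : ∀ y, P y → R.form y q ≠ 0 → ∃ t : ℝ, t ≠ 0 ∧ y = t • p := fun y hy hyq => by
    obtain ⟨c, hc⟩ := hy g hg
    exact ⟨_, div_ne_zero hyq h.ne, h.eq_smul_left_of_eigen R.symm hc hyq⟩
  have hPr : ∀ y, P y → R.form y p ≠ 0 → ∃ t : ℝ, t ≠ 0 ∧ y = t • q := fun y hy hyp => by
    obtain ⟨c, hc⟩ := hy g hg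
    exact ⟨_, div_ne_zero hyp h.ne, h.eq_smul_right_of_eigen R.symm hc hyp⟩
  have hPp : P p := by
    obtain ⟨w, hw⟩ := hR.exists_form_rep_ne_zero cs hx0 h.right_ne_zero
    obtain ⟨t, ht, hwx⟩ := hPl _ (hPW w x hx) hw
    exact hPs t p ht (hwx ▸ hPW w x hx)
  have hPq : P q := by
    obtain ⟨w, hw⟩ := hR.exists_form_rep_ne_zero cs hx0 h.left_ne_zero
    obtain ⟨t, ht, hwx⟩ := hPr _ (hPW w x hx) hw
    exact hPs t q ht (hwx ▸ hPW w x hx)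
  have hpp := h.left_left
  have hqq := h.right_right
  have hrefl : ∀ i y, R.form y y = 0 → R.form (R.refl i y) y = -2 * R.form (R.root i) y ^ 2 := by
    intro i y hy
    rw [refl_apply, LinearMap.map_sub₂, LinearMap.map_smul₂, hy, smul_eq_mul]
    ring
  have hmem : ∀ i y t, R.form (R.root i) y ≠ 0 → y ∈ Submodule.span ℝ {p, q} →
      t ∈ Submodule.span ℝ {p, q} → R.refl i y = t → R.root i ∈ Submodule.span ℝ {p, q} := by
    intro i y t hy hyS htS ht
    rw [refl_apply, sub_eq_iff_eq_add, add_comm, ← sub_eq_iff_eq_add] at ht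
    have := Submodule.sub_mem _ hyS htS
    rw [ht] at this
    exact (Submodule.smul_mem_iff _ (mul_ne_zero two_ne_zero hy)).1 this
  have hpS : p ∈ Submodule.span ℝ {p, q} := Submodule.subset_span (by simp)
  have hqS : q ∈ Submodule.span ℝ {p, q} := Submodule.subset_span (by simp)
  have hspan : Submodule.span ℝ {p, q} = ⊤ := by
    refine hR.eq_top _ (fun h0 => h.left_ne_zero ?_) fun i x hx => ?_
    · rwa [h0, Submodule.mem_bot] at hpS
    rw [refl_apply]
    refine Submodule.sub_mem _ hx ?_
    by_cases hi : R.root i ∈ Submodule.span ℝ {p, q}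
    · exact Submodule.smul_mem _ _ hi
    have hip : R.form (R.root i) p = 0 := by
      by_contra hip
      obtain ⟨t, -, ht⟩ := hPr _ (by simpa using hPW (cs.simple i) p hPp)
        (by rw [hrefl i p hpp]; simpa using hip)
      exact hi (hmem i p _ hip hpS (Submodule.smul_mem _ t hqS) ht)
    have hiq : R.form (R.root i) q = 0 := by
      by_contra hiq
      obtain ⟨t, -, ht⟩ := hPl _ (by simpa using hPW (cs.simple i) q hPq)
        (by rw [hrefl i q hqq]; simpa using hiq)
      exact hi (hmem i q _ hiq hqS (Submodule.smul_mem _ t hpS) ht)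
    obtain ⟨c, d, rfl⟩ := Submodule.mem_span_pair.1 hx
    simp [hip, hiq]
  exact hB.not_ge (card_le_two_of_span_eq_top hpp hqq hpq hspan)

theorem eq_top_of_normal [FiniteDimensional ℝ V] (hB : 2 < Fintype.card B) {N : Subgroup W}
    [hN : N.Normal] {g : W} (hg : g ∈ N) {ν : ℝ} {p q : V}
    (h : IsAxis R.form (R.rep cs g) ν p q) (hpq : R.form p q < 0) {U : Submodule ℝ V}
    (hU : U ≠ ⊥) (hUN : ∀ n ∈ N, ∀ x ∈ U, R.rep cs n x ∈ U) : U = ⊤ := by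
  obtain ⟨U₀, ⟨hU₀, hle, hinv⟩, hmin⟩ := WellFounded.has_min (wellFounded_lt (α := Submodule ℝ V))
    {U' | U' ≠ ⊥ ∧ U' ≤ U ∧ ∀ n ∈ N, ∀ x ∈ U', R.rep cs n x ∈ U'} ⟨U, hU, le_rfl, hUN⟩
  suffices h0 : U₀ = ⊤ from top_le_iff.1 (h0 ▸ hle)
  refine hR.eq_top _ hU₀ ?_
  by_contra! hcon
  obtain ⟨i, x, hx, hix⟩ := hcon
  have hconj : ∀ n ∈ N, ∀ y, R.refl i y ∈ U₀ → R.refl i (R.rep cs n y) ∈ U₀ := by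
    intro n hn y hy
    have := hinv _ (hN.conj_mem n hn (cs.simple i)) _ hy
    rwa [← rep_simple R cs, ← rep_mul_apply, inv_mul_cancel_right, rep_mul_apply,
      rep_simple] at this
  have hbot : U₀ ⊓ U₀.comap (R.refl i) = ⊥ := by
    by_contra hne
    refine hmin (U₀ ⊓ U₀.comap (R.refl i)) ⟨hne, inf_le_left.trans hle, ?_⟩
      (lt_of_le_of_ne inf_le_left fun heq => hix ?_)
    · rintro n hn y ⟨hy1, hy2⟩
      exact ⟨hinv n hn y hy1, hconj n hn y hy2⟩
    · exact (heq.ge hx).2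
  have hker : ∀ y ∈ U₀, R.form (R.root i) y = 0 → y = 0 := by
    intro y hy hiy
    rw [← Submodule.mem_bot ℝ, ← hbot]
    refine ⟨hy, ?_⟩
    rw [SetLike.mem_coe, Submodule.mem_comap, refl_apply, hiy]
    simpa using hy
  have hx0 : R.form (R.root i) x ≠ 0 := fun h0 => hix (by simpa [refl_apply, h0] using hx)
  refine hx0 ?_
  suffices hx : x = 0 by rw [hx, map_zero]
  refine hR.eq_zero_of_forall_mem_eigen hB hg h hpq fun n hn => ?_
  refine ⟨R.form (R.root i) (R.rep cs n x) / R.form (R.root i) x, sub_eq_zero.1 ?_⟩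
  refine hker _ (U₀.sub_mem (hinv n hn x hx) (U₀.smul_mem _ hx)) ?_
  simp [hx0]

/-- Subgroups of finite index act irreducibly. -/
theorem eq_top_of_finiteIndex [Infinite W] [FiniteDimensional ℝ V] (hB : 2 < Fintype.card B)
    (H : Subgroup W) [H.FiniteIndex] {U : Submodule ℝ V} (hU : U ≠ ⊥)
    (hUH : ∀ h ∈ H, ∀ x ∈ U, R.rep cs h x ∈ U) : U = ⊤ := by
  have : Nonempty B := Fintype.card_pos_iff.1 (by omega)
  obtain ⟨g, hg, ν, p, q, h⟩ := hR.exists_isAxis_mem cs H.normalCore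
  obtain ⟨p, q, h, -, hpq, -⟩ := hR.exists_oriented cs h
  have hpq' : R.form p q < 0 := lt_of_le_of_ne (by simpa using hpq 1) h.ne
  exact hR.eq_top_of_normal hB hg h hpq' hU fun n hn => hUH n (H.normalCore_le hn)

end RootSpace.IsHyperbolic

namespace RootSpace

variable {B W V : Type*} [Group W] {M : CoxeterMatrix B} [AddCommGroup V] [Module ℝ V]
  {R : RootSpace M V} {cs : CoxeterSystem M W} {v : V}

theorem form_eq_zero_of_eigen {w : W} {x y : V} {s t : ℝ} (hx : R.rep cs w x = s • x)
    (hy : R.rep cs w y = t • y) (hst : s * t ≠ 1) : R.form x y = 0 := by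
  have h := R.form_rep cs w x y
  rw [hx, hy, map_smul, LinearMap.map_smul₂, smul_eq_mul, smul_eq_mul] at h
  have h1 : (s * t - 1) * R.form x y = 0 := by linarith
  exact (mul_eq_zero.1 h1).resolve_left (sub_ne_zero.2 hst)

theorem rep_comm {w w' : W} (h : Commute w w') (x : V) :
    R.rep cs w (R.rep cs w' x) = R.rep cs w' (R.rep cs w x) := by
  rw [← rep_mul_apply, h.eq, rep_mul_apply]

theorem rep_injective (w : W) : Function.Injective (R.rep cs w) :=
  Function.LeftInverse.injective (rep_inv_rep cs w)

theorem rep_inv_apply_of_eigen {w : W} {x : V} {s : ℝ} (hs : s ≠ 0)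
    (hx : R.rep cs w x = s • x) : R.rep cs w⁻¹ x = s⁻¹ • x := by
  apply rep_injective (cs := cs) w
  rw [rep_rep_inv, map_smul, hx, smul_smul, inv_mul_cancel₀ hs, one_smul]

/-- An axis whose isotropic vectors have nonpositive products with their translates. -/
structure IsOrientedAxis (R : RootSpace M V) (cs : CoxeterSystem M W) (g : W) (ν : ℝ)
    (p q : V) : Prop where
  axis : IsAxis R.form (R.rep cs g) ν p q
  left_left : ∀ w, R.form (R.rep cs w p) p ≤ 0
  left_right : ∀ w, R.form (R.rep cs w p) q ≤ 0
  right_right : ∀ w, R.form (R.rep cs w q) q ≤ 0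

namespace IsOrientedAxis

variable {g : W} {ν : ℝ} {p q : V}

theorem neg (h : R.IsOrientedAxis cs g ν p q) : R.form p q < 0 :=
  lt_of_le_of_ne (by simpa using h.left_right 1) h.axis.ne

theorem right_left (h : R.IsOrientedAxis cs g ν p q) (w : W) :
    R.form (R.rep cs w q) p ≤ 0 := by
  rw [form_rep_left, R.symm]
  exact h.left_right _

theorem exists_smul_of_commute (h : R.IsOrientedAxis cs g ν p q) {w : W} (hw : Commute w g) :
    ∃ μ : ℝ, 0 < μ ∧ R.rep cs w p = μ • p ∧ R.rep cs w q = μ⁻¹ • q := by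
  have hp := h.axis.eq_smul_left R.symm (x := R.rep cs w p)
    (by rw [rep_comm hw.symm, h.axis.left, map_smul])
  have hq := h.axis.eq_smul_right R.symm (x := R.rep cs w q)
    (by rw [rep_comm hw.symm, h.axis.right, map_smul])
  set s := R.form (R.rep cs w p) q / R.form p q with hs
  set t := R.form (R.rep cs w q) p / R.form p q
  have hst : s * t = 1 := by
    have := R.form_rep cs w p q
    rw [hp, hq, map_smul, LinearMap.map_smul₂, smul_eq_mul, smul_eq_mul] at this
    have h1 : (s * t - 1) * R.form p q = 0 := by linarith
    linarith [(mul_eq_zero.1 h1).resolve_right h.axis.ne]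
  have hs0 : 0 ≤ s := div_nonneg_of_nonpos (h.left_right w) h.neg.le
  refine ⟨s, lt_of_le_of_ne hs0 fun h0 => ?_, hp, ?_⟩
  · rw [← h0, zero_mul] at hst
    exact zero_ne_one hst
  · rw [← eq_inv_of_mul_eq_one_right hst]
    exact hq

end IsOrientedAxis

namespace IsHyperbolic

variable [Fintype B] (hR : R.IsHyperbolic v)
include hR

theorem exists_isOrientedAxis [Infinite W] [Nonempty B] (N : Subgroup W) [N.FiniteIndex] :
    ∃ g ∈ N, ∃ ν p q, R.IsOrientedAxis cs g ν p q := by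
  obtain ⟨g, hg, ν, p, q, h⟩ := hR.exists_isAxis_mem cs N
  obtain ⟨p, q, h, h1, h2, h3⟩ := hR.exists_oriented cs h
  exact ⟨g, hg, ν, p, q, h, h1, h2, h3⟩

theorem eq_one_of_rep_eq {w : W} (h : R.rep cs w v = v) : w = 1 := by
  by_contra hw
  have := form_rep_lt cs hR.form_root_neg hw
  rw [h] at this
  exact this.false

variable [Infinite W] [FiniteDimensional ℝ V] (hB : 2 < Fintype.card B) {A C : Subgroup W}
include hB

theorem eq_top_of_sup (hfin : (A ⊔ C).FiniteIndex) {U : Submodule ℝ V} (hU : U ≠ ⊥)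
    (hA : ∀ a ∈ A, ∀ x ∈ U, R.rep cs a x ∈ U) (hC : ∀ c ∈ C, ∀ x ∈ U, R.rep cs c x ∈ U) :
    U = ⊤ := by
  let S : Subgroup W :=
    { carrier := {w | ∀ x, R.rep cs w x ∈ U ↔ x ∈ U}
      mul_mem' := fun {w w'} hw hw' x => by rw [rep_mul_apply, hw, hw']
      one_mem' := fun x => by simp
      inv_mem' := fun {w} hw x => by rw [← hw, rep_rep_inv] }
  have hS : ∀ D : Subgroup W, (∀ a ∈ D, ∀ x ∈ U, R.rep cs a x ∈ U) → D ≤ S := fun D hD w hw x =>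
    ⟨fun h => by simpa [rep_inv_rep] using hD w⁻¹ (D.inv_mem hw) _ h, hD w hw x⟩
  exact hR.eq_top_of_finiteIndex hB (A ⊔ C) hU fun w hw x hx =>
    (sup_le (hS A hA) (hS C hC) hw x).2 hx

variable (hcomm : ∀ a ∈ A, ∀ c ∈ C, Commute a c) (hfin : (A ⊔ C).FiniteIndex)
include hcomm hfin

theorem eq_bot_of_line {h : V} (h0 : h ≠ 0) (hline : ∀ a ∈ A, ∃ χ : ℝ, R.rep cs a h = χ • h) :
    A = ⊥ := by
  have : Nonempty B := Fintype.card_pos_iff.1 (by omega)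
  choose! χ hχ using hline
  let U : Submodule ℝ V := ⨅ a ∈ A, LinearMap.ker (R.rep cs a - χ a • LinearMap.id)
  have hmem : ∀ x, x ∈ U ↔ ∀ a ∈ A, R.rep cs a x = χ a • x := by
    intro x
    simp [U, Submodule.mem_iInf, sub_eq_zero]
  have hU : U = ⊤ := by
    refine hR.eq_top_of_sup (cs := cs) hB hfin
      (fun hbot => h0 ?_) (fun a ha x hx => ?_) fun c hc x hx => ?_
    · rw [← Submodule.mem_bot ℝ, ← hbot]
      exact (hmem h).2 hχ
    · rw [(hmem x).1 hx a ha]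
      exact U.smul_mem _ hx
    · refine (hmem _).2 fun a ha => ?_
      rw [rep_comm (hcomm a ha c hc), (hmem x).1 hx a ha, map_smul]
  refine (Subgroup.eq_bot_iff_forall A).2 fun a ha => hR.eq_one_of_rep_eq (cs := cs) ?_
  have hav := (hmem v).1 (hU ▸ Submodule.mem_top) a ha
  have h1 := R.form_rep cs a v v
  have h2 := hR.form_rep_rep_neg cs a 1
  have h3 := hR.form_rep_rep_neg cs 1 1
  rw [hav, map_one, Module.End.one_apply, LinearMap.map_smul₂, smul_eq_mul] at h2
  rw [map_one, Module.End.one_apply] at h3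
  rw [hav, map_smul, LinearMap.map_smul₂, smul_eq_mul, smul_eq_mul] at h1
  have h4 : 0 < χ a := by
    by_contra! h4
    nlinarith
  have h5 : (χ a - 1) * ((χ a + 1) * R.form v v) = 0 := by linear_combination h1
  have h6 := (mul_eq_zero.1 h5).resolve_right (mul_ne_zero (by linarith) h3.ne)
  rw [hav, sub_eq_zero.1 h6, one_smul]

theorem eigenvalue_eq_of_one_lt (hC : C ≠ ⊥) {a c : W} (ha : a ∈ A) (hc : c ∈ C) {ν : ℝ} {p q : V}
    (h : R.IsOrientedAxis cs (a * c) ν p q) {s t : ℝ} (hs : 1 < s) (ht : 0 < t)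
    (hap : R.rep cs a p = s • p) (hcp : R.rep cs c p = t • p) (hcq : R.rep cs c q = t⁻¹ • q) :
    t = s := by
  by_contra hts
  have hs0 : s ≠ 0 := by linarith
  have hquad : ∀ x, R.rep cs a x = s • x →
      R.rep cs c (R.rep cs c x) - (t + s⁻¹) • R.rep cs c x + (t * s⁻¹) • x = 0 := by
    intro x hx
    obtain ⟨k, x₀, hx₀, hcx₀⟩ : ∃ (k : ℝ) (x₀ : V), x = k • p + x₀ ∧
        R.rep cs c x₀ = s⁻¹ • x₀ := by
      have hxp : R.form x p = 0 := form_eq_zero_of_eigen hx hap (by nlinarith)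
      have hfix := h.axis.fix_sub R.symm x
      rw [hxp, zero_div, zero_smul, sub_zero] at hfix
      set k := R.form x q / R.form p q
      refine ⟨k, x - k • p, by abel, ?_⟩
      rw [rep_mul_apply, rep_comm (hcomm a ha c hc), map_sub, map_smul, hx, hap, smul_comm,
        ← smul_sub, map_smul] at hfix
      rw [← hfix, smul_smul, inv_mul_cancel₀ hs0, one_smul, hfix]
    rw [hx₀]
    simp only [map_add, map_smul, hcp, hcx₀]
    module
  let D : Module.End ℝ V :=
    R.rep cs c ∘ₗ R.rep cs c - (t + s⁻¹) • R.rep cs c + (t * s⁻¹) • LinearMap.id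
  have hD : ∀ x, D x = R.rep cs c (R.rep cs c x) - (t + s⁻¹) • R.rep cs c x + (t * s⁻¹) • x :=
    fun x => rfl
  let U : Submodule ℝ V := ⨅ d ∈ C, LinearMap.ker (D ∘ₗ R.rep cs d)
  have hmem : ∀ x, x ∈ U ↔ ∀ d ∈ C, D (R.rep cs d x) = 0 := by
    intro x
    simp [U, Submodule.mem_iInf]
  have hU : U = ⊤ := by
    refine hR.eq_top_of_sup (cs := cs) hB hfin
      (fun hbot => h.axis.left_ne_zero ?_) (fun a' ha' x hx => ?_)
      fun c' hc' x hx => ?_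
    · rw [← Submodule.mem_bot ℝ, ← hbot]
      refine (hmem p).2 fun d hd => ?_
      rw [hD, hquad]
      rw [rep_comm (hcomm a ha d hd), hap, map_smul]
    · refine (hmem _).2 fun d hd => ?_
      have hDa : ∀ y, D (R.rep cs a' y) = R.rep cs a' (D y) := fun y => by
        simp only [hD, map_add, map_sub, map_smul, rep_comm (hcomm a' ha' c hc)]
      rw [← rep_comm (hcomm a' ha' d hd), hDa, (hmem x).1 hx d hd, map_zero]
    · refine (hmem _).2 fun d hd => ?_
      rw [← rep_mul_apply]
      exact (hmem x).1 hx _ (C.mul_mem hd hc')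
  have hD0 : ∀ x, D x = 0 := fun x => by
    simpa using (hmem x).1 (hU ▸ Submodule.mem_top) 1 C.one_mem
  have ht1 : t = 1 := by
    have h1 := hD0 q
    rw [hD, hcq, map_smul, hcq, smul_smul, smul_smul, ← sub_smul, ← add_smul] at h1
    have h2 := (smul_eq_zero.1 h1).resolve_right h.axis.right_ne_zero
    field_simp at h2
    have h3 : (t - s) * (t - 1) * (t + 1) = 0 := by linear_combination h2
    have h4 : t + 1 ≠ 0 := by linarith
    linarith [(mul_eq_zero.1 ((mul_eq_zero.1 h3).resolve_right h4)).resolve_left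
      (sub_ne_zero.2 hts)]
  have hc1 : c = 1 := by
    refine hR.eq_one_of_rep_eq (cs := cs) (sub_eq_zero.1 (hR.nondegenerate _ fun z => ?_))
    have hquad1 : ∀ x, R.rep cs c (R.rep cs c x) =
        (1 + s⁻¹) • R.rep cs c x - s⁻¹ • x := by
      intro x
      have := hD0 x
      rw [hD, ht1, one_mul] at this
      rw [← sub_eq_zero, ← this]
      abel
    have hy : R.rep cs c (R.rep cs c v - v) = s⁻¹ • (R.rep cs c v - v) := by
      rw [map_sub, hquad1]
      module
    have hu : R.rep cs c (R.rep cs c z - s⁻¹ • z) = (1 : ℝ) • (R.rep cs c z - s⁻¹ • z) := by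
      rw [map_sub, map_smul, hquad1]
      module
    have hs1 : s⁻¹ < 1 := inv_lt_one_of_one_lt₀ hs
    have h1 := form_eq_zero_of_eigen hy hu (by linarith)
    have h2 := R.form_rep cs c (R.rep cs c v - v) z
    have h3 : 0 < s⁻¹ := by positivity
    rw [map_sub, map_smul, smul_eq_mul, sub_eq_zero] at h1
    rw [hy, LinearMap.map_smul₂, h1, smul_eq_mul] at h2
    have h4 : (s⁻¹ * s⁻¹ - 1) * R.form (R.rep cs c v - v) z = 0 := by linarith
    exact (mul_eq_zero.1 h4).resolve_left (by nlinarith)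
  refine hC (hR.eq_bot_of_line (cs := cs) hB (fun c hc a ha => (hcomm a ha c hc).symm)
    (sup_comm A C ▸ hfin) h.axis.left_ne_zero fun d hd => ?_)
  rw [hc1, mul_one] at h
  obtain ⟨χ, -, hχ, -⟩ := h.exists_smul_of_commute (hcomm a ha d hd).symm
  exact ⟨χ, hχ⟩

end IsHyperbolic

end RootSpace

namespace RootSpace

variable {B W V : Type*} [Group W] {M : CoxeterMatrix B} [AddCommGroup V] [Module ℝ V]
  {R : RootSpace M V} {cs : CoxeterSystem M W} {v : V}

/-- An oriented axis of a product of `a ∈ A` and `c ∈ C`, where `A` and `C` commute, on whose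
isotropic vectors `a` and `c` act by the same eigenvalues. -/
structure IsSplitAxis (R : RootSpace M V) (cs : CoxeterSystem M W) (A C : Subgroup W) (a c : W)
    (s : ℝ) (p q : V) : Prop where
  comm : ∀ a ∈ A, ∀ c ∈ C, Commute a c
  mem_left : a ∈ A
  mem_right : c ∈ C
  oriented : ∃ ν, R.IsOrientedAxis cs (a * c) ν p q
  one_lt : 1 < s
  left_left : R.rep cs a p = s • p
  left_right : R.rep cs a q = s⁻¹ • q
  right_left : R.rep cs c p = s • p
  right_right : R.rep cs c q = s⁻¹ • q

namespace IsSplitAxis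

variable {A C : Subgroup W} {a c : W} {s : ℝ} {p q : V}

theorem form_neg (hs : R.IsSplitAxis cs A C a c s p q) : R.form p q < 0 := by
  obtain ⟨ν, ho⟩ := hs.oriented
  exact ho.neg

theorem inv_lt_one (hs : R.IsSplitAxis cs A C a c s p q) : s⁻¹ < 1 :=
  inv_lt_one_of_one_lt₀ hs.one_lt

theorem form_left_left (hs : R.IsSplitAxis cs A C a c s p q) : R.form p p = 0 := by
  obtain ⟨ν, ho⟩ := hs.oriented
  exact ho.axis.left_left

theorem form_right_right (hs : R.IsSplitAxis cs A C a c s p q) : R.form q q = 0 := by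
  obtain ⟨ν, ho⟩ := hs.oriented
  exact ho.axis.right_right

theorem fix (hs : R.IsSplitAxis cs A C a c s p q) {x : V} (hp : R.form x p = 0)
    (hq : R.form x q = 0) : R.rep cs a (R.rep cs c x) = x := by
  obtain ⟨ν, ho⟩ := hs.oriented
  rw [← rep_mul_apply]
  exact ho.axis.fix x hp hq

theorem right_eigen (hs : R.IsSplitAxis cs A C a c s p q) {x : V} (hp : R.form x p = 0)
    (hq : R.form x q = 0) {t : ℝ} (ht : t ≠ 0) (hx : R.rep cs a x = t • x) :
    R.rep cs c x = t⁻¹ • x := by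
  have h := hs.fix hp hq
  rw [rep_comm (hs.comm a hs.mem_left c hs.mem_right), hx, map_smul] at h
  rw [eq_inv_smul_iff₀ ht, h]

theorem left_eigen (hs : R.IsSplitAxis cs A C a c s p q) {x : V} (hp : R.form x p = 0)
    (hq : R.form x q = 0) {t : ℝ} (ht : t ≠ 0) (hx : R.rep cs c x = t • x) :
    R.rep cs a x = t⁻¹ • x := by
  have h := hs.fix hp hq
  rw [hx, map_smul] at h
  rw [eq_inv_smul_iff₀ ht, h]

/-- If `h` is orthogonal to `p` and `q` and lies in the `C`-orbit of `p` modulo `p`, then `A` maps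
`h` into the plane spanned by `h` and `q`. -/
theorem exists_smul_add_smul (hs : R.IsSplitAxis cs A C a c s p q) {d : W} (hd : d ∈ C) {k : ℝ}
    {h : V} (hdp : R.rep cs d p = k • p + h) (hhp : R.form h p = 0) (hhq : R.form h q = 0)
    {w : W} (hw : w ∈ A) : ∃ y z : ℝ, 0 ≤ y ∧ 0 ≤ z ∧ R.rep cs w h = y • h + z • q := by
  obtain ⟨ν, ho⟩ := hs.oriented
  have hs1 := hs.one_lt
  have hs0 : s ≠ 0 := by linarith
  have hsi := hs.inv_lt_one
  have hsi0 : 0 < s⁻¹ := by positivity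
  have hκ := hs.form_neg.ne
  have hqp : R.form q p = R.form p q := R.symm q p
  have hadp := rep_comm (cs := cs) (R := R) (hs.comm a hs.mem_left d hd) p
  rw [hs.left_left, map_smul] at hadp
  have hah : R.rep cs a h = s • h := by
    rw [← add_sub_cancel_left (k • p) h, ← hdp, map_sub, map_smul, hadp, hs.left_left]
    module
  have hch := hs.right_eigen hhp hhq hs0 hah
  have hcwp : R.rep cs c (R.rep cs w p) = s • R.rep cs w p := by
    rw [← rep_comm (hs.comm w hw c hs.mem_right), hs.right_left, map_smul]
  have hcwh : R.rep cs c (R.rep cs w h) = s⁻¹ • R.rep cs w h := by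
    rw [← rep_comm (hs.comm w hw c hs.mem_right), hch, map_smul]
  have hwpp : R.form (R.rep cs w p) p = 0 :=
    form_eq_zero_of_eigen hcwp hs.right_left (by nlinarith)
  have hwhq : R.form (R.rep cs w h) q = 0 :=
    form_eq_zero_of_eigen hcwh hs.right_right (by nlinarith)
  obtain ⟨y, hy⟩ : ∃ y, y = R.form (R.rep cs w p) q / R.form p q := ⟨_, rfl⟩
  obtain ⟨z, hz⟩ : ∃ z, z = R.form (R.rep cs w h) p / R.form p q := ⟨_, rfl⟩
  obtain ⟨r, hr⟩ : ∃ r, r = R.rep cs w p - y • p := ⟨_, rfl⟩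
  obtain ⟨u, hu⟩ : ∃ u, u = R.rep cs w h - z • q := ⟨_, rfl⟩
  have har : R.rep cs a r = s⁻¹ • r := by
    refine hs.left_eigen ?_ ?_ hs0 ?_
    · rw [hr, LinearMap.map_sub₂, LinearMap.map_smul₂, hwpp, hs.form_left_left]; simp
    · rw [hr, LinearMap.map_sub₂, LinearMap.map_smul₂, hy, smul_eq_mul, div_mul_cancel₀ _ hκ,
        sub_self]
    · rw [hr, map_sub, map_smul, hcwp, hs.right_left]; module
  have hau : R.rep cs a u = s • u := by
    rw [← inv_inv s]
    refine hs.left_eigen ?_ ?_ hsi0.ne' ?_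
    · rw [hu, LinearMap.map_sub₂, LinearMap.map_smul₂, hz, smul_eq_mul, hqp,
        div_mul_cancel₀ _ hκ, sub_self]
    · rw [hu, LinearMap.map_sub₂, LinearMap.map_smul₂, hwhq, hs.form_right_right]; simp
    · rw [hu, map_sub, map_smul, hcwh, hs.right_right]; module
  have heq : u - y • h = R.rep cs d r - k • r - z • q := by
    have h1 := rep_comm (cs := cs) (R := R) (hs.comm w hw d hd) p
    have h2 : R.rep cs w p = y • p + r := by rw [hr]; abel
    have h3 : R.rep cs w h = u + z • q := by rw [hu]; abel
    rw [hdp, map_add, map_smul, h2, h3, map_add, map_smul, hdp, smul_add] at h1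
    have h4 : R.rep cs d r = (k • y • p + k • r + (u + z • q)) - y • (k • p + h) := by
      rw [h1]; abel
    rw [h4]; module
  have h1 : R.rep cs a (u - y • h) = s • (u - y • h) := by
    rw [map_sub, map_smul, hau, hah]; module
  have h2 : R.rep cs a (u - y • h) = s⁻¹ • (u - y • h) := by
    rw [heq, map_sub, map_sub, map_smul, map_smul, rep_comm (hs.comm a hs.mem_left d hd), har,
      hs.left_right, map_smul]
    module
  have h3 : u - y • h = 0 := by
    rw [h1, ← sub_eq_zero, ← sub_smul] at h2
    exact (smul_eq_zero.1 h2).resolve_left (by linarith)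
  refine ⟨y, z, hy ▸ div_nonneg_of_nonpos (ho.left_right w) hs.form_neg.le, ?_, ?_⟩
  · rw [hz]
    refine div_nonneg_of_nonpos ?_ hs.form_neg.le
    have h4 := ho.left_left (w * d)
    rwa [rep_mul_apply, hdp, map_add, map_smul, LinearMap.map_add₂, LinearMap.map_smul₂, hwpp,
      smul_zero, zero_add] at h4
  · rw [← sub_eq_zero, ← h3, hu]
    abel

end IsSplitAxis

end RootSpace

theorem exists_mul_eq_of_mem_sup {W : Type*} [Group W] {A C : Subgroup W}
    (hcomm : ∀ a ∈ A, ∀ c ∈ C, Commute a c) {g : W} (hg : g ∈ A ⊔ C) :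
    ∃ a ∈ A, ∃ c ∈ C, a * c = g := by
  let S : Subgroup W :=
    { carrier := {g | ∃ a ∈ A, ∃ c ∈ C, a * c = g}
      mul_mem' := by
        rintro _ _ ⟨a, ha, c, hc, rfl⟩ ⟨a', ha', c', hc', rfl⟩
        refine ⟨a * a', A.mul_mem ha ha', c * c', C.mul_mem hc hc', ?_⟩
        rw [mul_assoc, mul_assoc, ← mul_assoc a', (hcomm a' ha' c hc).eq, mul_assoc]
      one_mem' := ⟨1, A.one_mem, 1, C.one_mem, mul_one 1⟩
      inv_mem' := by
        rintro _ ⟨a, ha, c, hc, rfl⟩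
        refine ⟨a⁻¹, A.inv_mem ha, c⁻¹, C.inv_mem hc, ?_⟩
        rw [(hcomm a ha c hc).eq, mul_inv_rev] }
  have hA : A ≤ S := fun a ha => ⟨a, ha, 1, C.one_mem, mul_one a⟩
  have hC : C ≤ S := fun c hc => ⟨1, A.one_mem, c, hc, one_mul c⟩
  exact sup_le hA hC hg

theorem finiteIndex_of_two_cosets {W : Type*} [Group W] {K L : Subgroup W} (hKL : K ≤ L)
    (hL : L.FiniteIndex) {c : W} (hc : c ∈ L) (h : ∀ g ∈ L, g ∈ K ∨ c⁻¹ * g ∈ K) :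
    K.FiniteIndex := by
  let f : Bool → L ⧸ K.subgroupOf L := fun b =>
    if b then QuotientGroup.mk 1 else QuotientGroup.mk ⟨c, hc⟩
  have hf : Function.Surjective f := by
    intro x
    obtain ⟨g, rfl⟩ := QuotientGroup.mk_surjective x
    rcases h g g.2 with hg | hg
    · exact ⟨true, QuotientGroup.eq.2 (by simpa [Subgroup.mem_subgroupOf] using hg)⟩
    · exact ⟨false, QuotientGroup.eq.2 (by simpa [Subgroup.mem_subgroupOf] using hg)⟩
  have := Finite.of_surjective f hf
  have h1 : (K.subgroupOf L).FiniteIndex := Subgroup.finiteIndex_of_finite_quotient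
  refine ⟨?_⟩
  rw [← Subgroup.relIndex_mul_index hKL]
  exact mul_ne_zero h1.index_ne_zero hL.index_ne_zero

namespace RootSpace.IsHyperbolic

variable {B W V : Type*} [Group W] {M : CoxeterMatrix B} [AddCommGroup V] [Module ℝ V]
  {R : RootSpace M V} {cs : CoxeterSystem M W} {v : V} [Fintype B] (hR : R.IsHyperbolic v)
  [Infinite W] [FiniteDimensional ℝ V] (hB : 2 < Fintype.card B) {A C : Subgroup W}
  (hfin : (A ⊔ C).FiniteIndex)
include hR hB hfin

theorem exists_isSplitAxis (hcomm : ∀ a ∈ A, ∀ c ∈ C, Commute a c) (hA : A ≠ ⊥) (hC : C ≠ ⊥) :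
    ∃ a c s p q, R.IsSplitAxis cs A C a c s p q := by
  have : Nonempty B := Fintype.card_pos_iff.1 (by omega)
  obtain ⟨g, hg, ν, p, q, h⟩ := hR.exists_isOrientedAxis (cs := cs) (A ⊔ C)
  obtain ⟨a, ha, c, hc, rfl⟩ := exists_mul_eq_of_mem_sup hcomm hg
  have hac := hcomm a ha c hc
  obtain ⟨s, hs, hap, haq⟩ := h.exists_smul_of_commute ((Commute.refl a).mul_right hac)
  obtain ⟨t, ht, hcp, hcq⟩ := h.exists_smul_of_commute (hac.symm.mul_right (Commute.refl c))
  have hst : ν = s * t := by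
    have h1 := h.axis.left
    rw [rep_mul_apply, hcp, map_smul, hap, smul_smul, ← sub_eq_zero, ← sub_smul] at h1
    linarith [(smul_eq_zero.1 h1).resolve_right h.axis.left_ne_zero]
  have hν := h.axis.one_lt
  have hts : t = s ∧ 1 < s := by
    by_cases hs1 : 1 < s
    · exact ⟨hR.eigenvalue_eq_of_one_lt hB hcomm hfin hC ha hc h hs1 ht hap hcp hcq, hs1⟩
    · have ht1 : 1 < t := by
        by_contra! ht1
        nlinarith
      rw [hac.eq] at h
      have := hR.eigenvalue_eq_of_one_lt hB (fun c hc a ha => (hcomm a ha c hc).symm)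
        (sup_comm A C ▸ hfin) hA hc ha h ht1 hs hcp hap haq
      exact absurd (this ▸ ht1) hs1
  obtain ⟨rfl, hs1⟩ := hts
  exact ⟨a, c, t, p, q, hcomm, ha, hc, ⟨ν, h⟩, hs1, hap, haq, hcp, hcq⟩

theorem exists_mem_right_rep_eq (hC : C ≠ ⊥) {a c : W} {s : ℝ} {p q : V}
    (hs : R.IsSplitAxis cs A C a c s p q) :
    ∃ d ∈ C, ∃ (k : ℝ) (h : V), h ≠ 0 ∧ R.rep cs d p = k • p + h ∧ R.form h p = 0 ∧
      R.form h q = 0 := by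
  obtain ⟨ν, ho⟩ := hs.oriented
  by_contra! hcon
  refine hC (hR.eq_bot_of_line (cs := cs) hB (fun c hc a ha => (hs.comm a ha c hc).symm)
    (sup_comm A C ▸ hfin) ho.axis.left_ne_zero fun d hd => ?_)
  refine ⟨R.form (R.rep cs d p) q / R.form p q, sub_eq_zero.1 ?_⟩
  by_contra hne
  refine hcon d hd _ _ hne (add_sub_cancel _ _).symm ?_ ?_
  · have h1 : R.rep cs a (R.rep cs d p) = s • R.rep cs d p := by
      rw [rep_comm (hs.comm a hs.mem_left d hd), hs.left_left, map_smul]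
    have h2 := form_eq_zero_of_eigen h1 hs.left_left (by nlinarith [hs.one_lt])
    rw [LinearMap.map_sub₂, LinearMap.map_smul₂, h2, hs.form_left_left, smul_zero, sub_zero]
  · rw [LinearMap.map_sub₂, LinearMap.map_smul₂, smul_eq_mul, div_mul_cancel₀ _ hs.form_neg.ne,
      sub_self]

/-- Commuting subgroups which together generate a subgroup of finite index cannot both be
nontrivial. -/
theorem eq_bot_or_eq_bot (cs : CoxeterSystem M W) (hcomm : ∀ a ∈ A, ∀ c ∈ C, Commute a c) :
    A = ⊥ ∨ C = ⊥ := by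
  by_contra! hAC
  obtain ⟨hA, hC⟩ := hAC
  obtain ⟨a, c, s, p, q, hs⟩ := hR.exists_isSplitAxis (cs := cs) hB hfin hcomm hA hC
  obtain ⟨d, hd, k, h, h0, hdp, hhp, hhq⟩ := hR.exists_mem_right_rep_eq hB hfin hC hs
  obtain ⟨ν, ho⟩ := hs.oriented
  have hκ := hs.form_neg
  have hqp : R.form q p = R.form p q := R.symm q p
  have hs0 : s ≠ 0 := by linarith [hs.one_lt]
  have hplane : ∀ w ∈ A, ∃ y z : ℝ, 0 ≤ y ∧ 0 ≤ z ∧ R.rep cs w h = y • h + z • q := fun w hw =>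
    hs.exists_smul_add_smul hd hdp hhp hhq hw
  have hind : ∀ {x y : ℝ}, x • h + y • q = 0 → x = 0 ∧ y = 0 := by
    intro x y hxy
    have h1 : R.form (x • h + y • q) p = 0 := by simp [hxy]
    have hy : y = 0 := by
      rw [LinearMap.map_add₂, LinearMap.map_smul₂, LinearMap.map_smul₂, hhp, hqp] at h1
      simpa [hκ.ne] using h1
    rw [hy, zero_smul, add_zero] at hxy
    exact ⟨(smul_eq_zero.1 hxy).resolve_right h0, hy⟩
  let A₁ : Subgroup W :=
    { carrier := {w | w ∈ A ∧ ∃ y : ℝ, y ≠ 0 ∧ R.rep cs w h = y • h}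
      mul_mem' := by
        rintro w w' ⟨hw, y, hy, hwh⟩ ⟨hw', y', hy', hwh'⟩
        refine ⟨A.mul_mem hw hw', y' * y, mul_ne_zero hy' hy, ?_⟩
        rw [rep_mul_apply, hwh', map_smul, hwh, smul_smul]
      one_mem' := ⟨A.one_mem, 1, one_ne_zero, by simp⟩
      inv_mem' := by
        rintro w ⟨hw, y, hy, hwh⟩
        exact ⟨A.inv_mem hw, y⁻¹, inv_ne_zero hy, rep_inv_apply_of_eigen hy hwh⟩ }
  have hA₁ : A₁ ≤ A := fun w hw => hw.1
  have haA₁ : a ∈ A₁ := by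
    refine ⟨hs.mem_left, s, hs0, ?_⟩
    rw [← add_sub_cancel_left (k • p) h, ← hdp, map_sub, map_smul,
      rep_comm (hs.comm a hs.mem_left d hd), hs.left_left, map_smul]
    module
  have hfin₁ : (A₁ ⊔ C).FiniteIndex := by
    by_cases hle : A ≤ A₁
    · rwa [le_antisymm hA₁ hle]
    obtain ⟨e, he, heA₁⟩ := Set.not_subset.1 hle
    have hne : ∀ w ∈ A, w ∉ A₁ → ∀ y z : ℝ, R.rep cs w h = y • h + z • q → z ≠ 0 := by
      rintro w hw hwA₁ y z hwh rfl
      rw [zero_smul, add_zero] at hwh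
      refine hwA₁ ⟨hw, y, fun hy => h0 (rep_injective (cs := cs) (R := R) w ?_), hwh⟩
      rw [hwh, hy, zero_smul, map_zero]
    have hplane' : ∀ w ∈ A, ∃ y z : ℝ, 0 ≤ y ∧ R.rep cs w q = y • q + z • h := by
      intro w hw
      obtain ⟨y₁, z₁, -, -, heh⟩ := hplane e he
      obtain ⟨y₂, z₂, -, -, hweh⟩ := hplane (w * e) (A.mul_mem hw he)
      obtain ⟨y₃, z₃, -, -, hwh⟩ := hplane w hw
      have hz₁ := hne e he heA₁ y₁ z₁ heh
      have hwq : R.rep cs w q = (z₁⁻¹ * (z₂ - y₁ * z₃)) • q + (z₁⁻¹ * (y₂ - y₁ * y₃)) • h := by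
        rw [rep_mul_apply, heh, map_add, map_smul, map_smul, hwh] at hweh
        have h1 : z₁ • R.rep cs w q = (y₂ • h + z₂ • q) - y₁ • (y₃ • h + z₃ • q) := by
          rw [← hweh]; abel
        rw [← inv_smul_smul₀ hz₁ (R.rep cs w q), h1]
        module
      refine ⟨_, _, ?_, hwq⟩
      have h1 := ho.right_left w
      rw [hwq, LinearMap.map_add₂, LinearMap.map_smul₂, LinearMap.map_smul₂, hhp, hqp, smul_zero,
        add_zero, smul_eq_mul] at h1
      exact nonneg_of_mul_nonpos_left h1 hκ
    have hswap : ∀ w ∈ A, w ∉ A₁ → ∃ z : ℝ, z ≠ 0 ∧ R.rep cs w h = z • q := by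
      intro w hw hwA₁
      obtain ⟨y, z, hy, hz, hwh⟩ := hplane w hw
      obtain ⟨Y, Z, -, hZ, hwh'⟩ := hplane w⁻¹ (A.inv_mem hw)
      obtain ⟨Y', T, hY', hwq'⟩ := hplane' w⁻¹ (A.inv_mem hw)
      have hz0 := hne w hw hwA₁ y z hwh
      have h1 := rep_inv_rep (R := R) cs w h
      rw [hwh, map_add, map_smul, map_smul, hwh', hwq', ← sub_eq_zero] at h1
      have h2 := (hind (x := y * Y + z * T - 1) (y := y * Z + z * Y') (by rw [← h1]; module)).2
      have h3 : z * Y' = 0 := by linarith [mul_nonneg hy hZ, mul_nonneg hz hY']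
      have h4 := rep_rep_inv (R := R) cs w q
      rw [hwq', (mul_eq_zero.1 h3).resolve_left hz0, zero_smul, zero_add, map_smul, hwh,
        ← sub_eq_zero] at h4
      obtain ⟨h5, h6⟩ := hind (x := T * y) (y := T * z - 1) (by rw [← h4]; module)
      have hT : T ≠ 0 := by
        rintro rfl
        simp at h6
      exact ⟨z, hz0, by rw [hwh, (mul_eq_zero.1 h5).resolve_left hT, zero_smul, zero_add]⟩
    obtain ⟨z₁, hz₁, heh⟩ := hswap e he heA₁
    refine finiteIndex_of_two_cosets (sup_le_sup_right hA₁ C) hfin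
      (Subgroup.mem_sup_left he) fun g hg => ?_
    obtain ⟨w, hw, d', hd', rfl⟩ := exists_mul_eq_of_mem_sup hcomm hg
    by_cases hwA₁ : w ∈ A₁
    · exact Or.inl (Subgroup.mul_mem_sup hwA₁ hd')
    · obtain ⟨z₂, hz₂, hwh⟩ := hswap w hw hwA₁
      right
      rw [← mul_assoc]
      refine Subgroup.mul_mem_sup ⟨A.mul_mem (A.inv_mem he) hw, z₂ * z₁⁻¹,
        mul_ne_zero hz₂ (inv_ne_zero hz₁), ?_⟩ hd'
      have h1 := rep_inv_rep (R := R) cs e h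
      rw [heh, map_smul] at h1
      rw [rep_mul_apply, hwh, map_smul, mul_smul, ← h1, inv_smul_smul₀ hz₁]
  have hbot := hR.eq_bot_of_line hB (fun w hw => hcomm w (hA₁ hw)) hfin₁ h0
    (cs := cs) fun w hw => ⟨_, hw.2.choose_spec.2⟩
  rw [hbot, Subgroup.mem_bot] at haA₁
  have h1 := hs.left_left
  rw [haA₁, map_one, Module.End.one_apply, ← sub_eq_zero] at h1
  have h2 : (1 - s) • p = 0 := by rw [← h1]; module
  have h3 := (smul_eq_zero.1 h2).resolve_right ho.axis.left_ne_zero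
  linarith [hs.one_lt]

end RootSpace.IsHyperbolic

section Perron

variable {B : Type*} [Fintype B] {M : CoxeterMatrix B}

theorem bilin_symm (M : CoxeterMatrix B) (x y : B → ℝ) : bilin M x y = bilin M y x := by
  rw [bilin, bilin, Finset.sum_comm]
  refine Finset.sum_congr rfl fun i _ => Finset.sum_congr rfl fun j _ => ?_
  rw [formEntry_symm]
  ring

/-- The standard bilinear form as a bilinear map. -/
noncomputable def bilinMap (M : CoxeterMatrix B) : (B → ℝ) →ₗ[ℝ] (B → ℝ) →ₗ[ℝ] ℝ :=
  LinearMap.mk₂ ℝ (bilin M)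
    (fun x x' y => by simp [bilin, add_mul, Finset.sum_add_distrib])
    (fun c x y => by simp [bilin, Finset.mul_sum, mul_assoc])
    (fun x y y' => by simp [bilin, mul_add, add_mul, Finset.sum_add_distrib])
    (fun c x y => by simp [bilin, Finset.mul_sum, mul_assoc, mul_left_comm])

theorem bilinMap_apply (x y : B → ℝ) : bilinMap M x y = bilin M x y := rfl

theorem bilinMap_single_left [DecidableEq B] (i : B) (y : B → ℝ) :
    bilinMap M (Pi.single i 1) y = ∑ j, y j * formEntry M i j := by
  simp [bilinMap_apply, bilin, Pi.single_apply]

theorem bilinMap_single_single [DecidableEq B] (i j : B) :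
    bilinMap M (Pi.single i 1) (Pi.single j 1) = formEntry M i j := by
  simp [bilinMap_single_left, Pi.single_apply]

omit [Fintype B] in
theorem forall_of_forall_adj (hirr : IsIrreducible M) {P : B → Prop}
    (hadj : ∀ i j, i ≠ j → M i j ≠ 2 → P i → P j) {i : B} (hi : P i) (j : B) : P j := by
  obtain ⟨w⟩ := hirr.preconnected i j
  induction w with
  | nil => exact hi
  | cons h _ ih =>
    rw [coxeterGraph, SimpleGraph.fromRel_adj] at h
    refine ih (hadj _ _ h.1 ?_ hi)
    rcases h.2 with h2 | h2
    · exact h2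
    · rwa [M.symmetric]

theorem exists_isMinOn_bilin (h : ¬ IsPosSemidef M) :
    ∃ (m : ℝ) (x : B → ℝ), m < 0 ∧ x ≠ 0 ∧ bilin M x x = m * ∑ i, x i ^ 2 ∧
      ∀ y, m * ∑ i, y i ^ 2 ≤ bilin M y y := by
  let K : Set (B → ℝ) := {x | ∑ i, x i ^ 2 = 1}
  have hK : IsCompact K := by
    refine Metric.isCompact_of_isClosed_isBounded
      (isClosed_eq (by fun_prop) continuous_const)
      ((Metric.isBounded_closedBall (x := 0) (r := 1)).subset fun x hx => ?_)
    rw [mem_closedBall_zero_iff, pi_norm_le_iff_of_nonneg zero_le_one]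
    intro i
    have h1 : x i ^ 2 ≤ 1 :=
      (Finset.single_le_sum (f := fun i => x i ^ 2) (fun i _ => sq_nonneg (x i))
        (Finset.mem_univ i)).trans (le_of_eq hx)
    rw [Real.norm_eq_abs]
    exact (sq_le_one_iff_abs_le_one _).1 h1
  have hsum : ∀ y : B → ℝ, y ≠ 0 → 0 < ∑ i, y i ^ 2 := by
    intro y hy
    obtain ⟨i, hi⟩ := Function.ne_iff.1 hy
    exact Finset.sum_pos' (fun i _ => sq_nonneg (y i)) ⟨i, Finset.mem_univ i, sq_pos_of_ne_zero hi⟩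
  have hscale : ∀ y : B → ℝ, y ≠ 0 → ∃ r : ℝ, r ^ 2 * ∑ i, y i ^ 2 = 1 ∧ r • y ∈ K := by
    intro y hy
    have h1 := hsum y hy
    have h2 : ((√(∑ i, y i ^ 2))⁻¹) ^ 2 * ∑ i, y i ^ 2 = 1 := by
      rw [inv_pow, Real.sq_sqrt h1.le, inv_mul_cancel₀ h1.ne']
    refine ⟨_, h2, ?_⟩
    change ∑ i, (_ * y i) ^ 2 = 1
    simp only [mul_pow, ← Finset.mul_sum]
    exact h2
  have hquad : ∀ (r : ℝ) (y : B → ℝ), bilin M (r • y) (r • y) = r ^ 2 * bilin M y y := by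
    intro r y
    simp only [← bilinMap_apply, map_smul, LinearMap.smul_apply, smul_eq_mul]
    ring
  unfold IsPosSemidef at h
  push Not at h
  obtain ⟨z, hz⟩ := h
  have hz0 : z ≠ 0 := by
    rintro rfl
    simp [bilin] at hz
  obtain ⟨r, hr, hrz⟩ := hscale z hz0
  obtain ⟨x, hx, hmin⟩ := hK.exists_isMinOn ⟨_, hrz⟩
    (f := fun x => bilin M x x) (by unfold bilin; fun_prop)
  have hx1 : ∑ i, x i ^ 2 = 1 := hx
  refine ⟨bilin M x x, x, ?_, ?_, by rw [hx1, mul_one], fun y => ?_⟩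
  · have h1 : bilin M x x ≤ bilin M (r • z) (r • z) := hmin hrz
    have h2 : 0 < r ^ 2 := by
      by_contra! h2
      nlinarith [hsum z hz0]
    rw [hquad] at h1
    nlinarith
  · rintro rfl
    simp at hx1
  · by_cases hy : y = 0
    · simp [hy, bilin]
    obtain ⟨r, hr, hry⟩ := hscale y hy
    have h1 : bilin M x x ≤ bilin M (r • y) (r • y) := hmin hry
    have h2 := hsum y hy
    rw [hquad] at h1
    have h3 : bilin M y y = (r ^ 2 * ∑ i, y i ^ 2) * bilin M y y := by rw [hr, one_mul]
    nlinarith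

/-- A Perron–Frobenius vector of an indefinite irreducible Coxeter matrix. -/
theorem exists_perron [DecidableEq B] (hirr : IsIrreducible M) (h : ¬ IsPosSemidef M) :
    ∃ u : B → ℝ, (∀ i, 0 ≤ u i) ∧ ∀ i, bilinMap M (Pi.single i 1) u < 0 := by
  obtain ⟨m, x, hm, hx, hxm, hmin⟩ := exists_isMinOn_bilin h
  let u : B → ℝ := fun i => |x i|
  have hu0 : ∀ i, 0 ≤ u i := fun i => abs_nonneg _
  have husq : ∑ i, u i ^ 2 = ∑ i, x i ^ 2 := by simp [u]
  have hum : bilin M u u = m * ∑ i, u i ^ 2 := by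
    refine le_antisymm ?_ (hmin u)
    rw [husq, ← hxm]
    refine Finset.sum_le_sum fun i _ => Finset.sum_le_sum fun j _ => ?_
    by_cases hij : i = j
    · simp [hij, u]
    · refine mul_le_mul_of_nonpos_right ?_ (formEntry_nonpos M hij)
      rw [← abs_mul]
      exact le_abs_self _
  have heig : ∀ i, bilinMap M (Pi.single i 1) u = m * u i := by
    intro i
    have hpoly : ∀ t : ℝ,
        0 ≤ (1 - m) * (t * t) + (2 * (bilinMap M (Pi.single i 1) u - m * u i)) * t + 0 := by
      intro t
      have h1 := hmin (u + t • Pi.single i 1)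
      have h2 : ∑ j, (u + t • Pi.single i 1 : B → ℝ) j ^ 2 = ∑ j, u j ^ 2 + 2 * t * u i + t ^ 2 := by
        simp only [Pi.add_apply, Pi.smul_apply, smul_eq_mul, add_sq, Finset.sum_add_distrib,
          mul_pow]
        simp [Pi.single_apply]
        ring
      rw [h2, ← bilinMap_apply] at h1
      simp only [map_add, map_smul, LinearMap.add_apply, LinearMap.smul_apply, smul_eq_mul,
        bilinMap_single_single, formEntry_self] at h1
      rw [bilinMap_apply u u, hum, bilinMap_apply u, bilin_symm, ← bilinMap_apply] at h1
      linarith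
    have h3 := discrim_le_zero hpoly
    rw [discrim] at h3
    nlinarith [sq_nonneg (bilinMap M (Pi.single i 1) u - m * u i)]
  have hpos : ∀ i, u i ≠ 0 := by
    intro i hi
    refine hx (funext fun j => ?_)
    have hall := forall_of_forall_adj hirr (P := fun i => u i = 0) (fun i j hij hM hi => ?_) hi j
    · exact abs_eq_zero.1 hall
    · have h1 := heig i
      rw [hi, mul_zero, bilinMap_single_left] at h1
      have hterm : ∀ k ∈ Finset.univ, u k * formEntry M i k ≤ 0 := by
        intro k _
        by_cases hik : i = k
        · rw [← hik, hi, zero_mul]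
        · exact mul_nonpos_of_nonneg_of_nonpos (hu0 k) (formEntry_nonpos M hik)
      have h2 := (Finset.sum_eq_zero_iff_of_nonpos hterm).1 h1 j (Finset.mem_univ j)
      exact (mul_eq_zero.1 h2).resolve_right (formEntry_neg M hij hM).ne
  refine ⟨u, hu0, fun i => ?_⟩
  rw [heig]
  exact mul_neg_of_neg_of_pos hm (lt_of_le_of_ne (hu0 i) (hpos i).symm)

end Perron

namespace RootSpace

variable {B : Type*} [Fintype B] {M : CoxeterMatrix B}

theorem IsHyperbolic.two_lt_card [Nonempty B] {V : Type*} [AddCommGroup V] [Module ℝ V]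
    {R : RootSpace M V} {v : V} (hR : R.IsHyperbolic v) : 2 < Fintype.card B := by
  classical
  by_contra! hcard
  obtain ⟨c, hc, hcv⟩ := hR.mem_cone
  obtain ⟨i, hi⟩ := Finite.exists_max c
  have h1 := hR.form_root_neg i
  rw [hcv] at h1
  simp only [map_sum, map_smul, R.gram, smul_eq_mul] at h1
  rw [← Finset.add_sum_erase _ _ (Finset.mem_univ i), formEntry_self, mul_one] at h1
  have h2 : ∑ j ∈ Finset.univ.erase i, -(c j * formEntry M i j) ≤
      (Finset.univ.erase i).card • c i := by
    refine Finset.sum_le_card_nsmul _ _ _ fun j _ => ?_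
    nlinarith [hi j, hc j, neg_one_le_formEntry M i j]
  rw [Finset.sum_neg_distrib, Finset.card_erase_of_mem (Finset.mem_univ i), Finset.card_univ,
    nsmul_eq_mul] at h2
  have h3 : ((Fintype.card B - 1 : ℕ) : ℝ) ≤ 1 := by exact_mod_cast (by omega)
  nlinarith [hc i]

/-- The quotient of the standard representation by the radical of the form. -/
noncomputable def quotient [DecidableEq B] (M : CoxeterMatrix B) :
    RootSpace M ((B → ℝ) ⧸ LinearMap.ker (bilinMap M)) where
  form := (LinearMap.ker (bilinMap M)).liftQ
    ((LinearMap.ker (bilinMap M)).liftQ (bilinMap M) le_rfl).flip (by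
      intro x hx
      ext y
      have h := LinearMap.congr_fun (LinearMap.mem_ker.1 hx) (Pi.single y 1)
      rw [bilinMap_apply, bilin_symm] at h
      simpa [bilinMap_apply] using h)
  symm x y := by
    obtain ⟨x, rfl⟩ := Submodule.mkQ_surjective _ x
    obtain ⟨y, rfl⟩ := Submodule.mkQ_surjective _ y
    exact bilin_symm M y x
  root i := Submodule.mkQ _ (Pi.single i 1)
  gram i j := (bilinMap_single_single j i).trans (formEntry_symm M j i)

theorem quotient_form_mkQ [DecidableEq B] (x y : B → ℝ) :
    (quotient M).form (Submodule.mkQ _ x) (Submodule.mkQ _ y) = bilinMap M x y :=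
  bilin_symm M y x

theorem mkQ_eq_sum_root [DecidableEq B] (x : B → ℝ) :
    Submodule.mkQ (LinearMap.ker (bilinMap M)) x = ∑ i, x i • (quotient M).root i := by
  simp only [quotient, ← map_smul, ← map_sum]
  congr 1
  ext j
  simp [Finset.sum_apply, Pi.single_apply]

theorem exists_isHyperbolic [DecidableEq B] (hirr : IsIrreducible M) (h : ¬ IsPosSemidef M) :
    ∃ v, (quotient M).IsHyperbolic v := by
  obtain ⟨u, hu0, hu⟩ := exists_perron hirr h
  have hnd : ∀ x, (∀ y, (quotient M).form x y = 0) → x = 0 := by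
    intro x hx
    obtain ⟨x, rfl⟩ := Submodule.mkQ_surjective _ x
    rw [← LinearMap.mem_ker, Submodule.ker_mkQ, LinearMap.mem_ker]
    refine LinearMap.ext fun y => ?_
    exact (quotient_form_mkQ x _).symm.trans (hx _)
  refine ⟨Submodule.mkQ _ u, hnd, fun U hU hinv => ?_, ⟨u, hu0, mkQ_eq_sum_root u⟩, fun i => ?_⟩
  · obtain ⟨x, hxU, hx⟩ := (Submodule.ne_bot_iff U).1 hU
    have hmem : ∀ (i : B), ∀ x ∈ U, (quotient M).form ((quotient M).root i) x ≠ 0 →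
        (quotient M).root i ∈ U := by
      intro i x hxU hix
      have h1 := U.sub_mem hxU (hinv i x hxU)
      rw [refl_apply, sub_sub_cancel] at h1
      exact (U.smul_mem_iff (mul_ne_zero two_ne_zero hix)).1 h1
    obtain ⟨i, hi⟩ : ∃ i, (quotient M).form ((quotient M).root i) x ≠ 0 := by
      by_contra! hcon
      refine hx (hnd x fun y => ?_)
      obtain ⟨y, rfl⟩ := Submodule.mkQ_surjective _ y
      rw [mkQ_eq_sum_root, (quotient M).symm]
      simp [hcon]
    have hall := forall_of_forall_adj hirr (P := fun i => (quotient M).root i ∈ U)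
      (fun i j hij hM hi => hmem j _ hi ?_) (hmem i x hxU hi)
    · refine Submodule.eq_top_iff'.2 fun y => ?_
      obtain ⟨y, rfl⟩ := Submodule.mkQ_surjective _ y
      rw [mkQ_eq_sum_root]
      exact U.sum_mem fun i _ => U.smul_mem _ (hall i)
    · rw [gram, formEntry_symm]
      exact (formEntry_neg M hij hM).ne
  · exact (quotient_form_mkQ _ u).trans_lt (hu i)

end RootSpace

/-- No finite index subgroup of an irreducible, infinite, non-affine
Coxeter group can be expressed as an internal direct product of two nontrivial
subgroups. -/
theorem no_direct_product_decomposition_of_finiteIndex_subgroup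
    {B W : Type*} [Fintype B] [Group W] {M : CoxeterMatrix B} (cs : CoxeterSystem M W)
    (hirr : IsIrreducible M) (hinf : Infinite W)
    (hnonaff : ¬ IsPosDef M ∧ ¬ IsPosSemidef M)
    (G : Subgroup W) (hG : G.FiniteIndex) :
    ¬ ∃ A B' : Subgroup G, A ≠ ⊥ ∧ B' ≠ ⊥ ∧ A.Normal ∧ B'.Normal ∧
        A ⊓ B' = ⊥ ∧ A ⊔ B' = ⊤ := by
  classical
  rintro ⟨A, C, hA, hC, hAn, hCn, hdisj, hsup⟩
  obtain ⟨v, hR⟩ := RootSpace.exists_isHyperbolic hirr hnonaff.2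
  have : Nonempty B := hirr.nonempty
  have hcomm : ∀ a ∈ A.map G.subtype, ∀ c ∈ C.map G.subtype, Commute a c := by
    rintro _ ⟨a, ha, rfl⟩ _ ⟨c, hc, rfl⟩
    exact (Subgroup.commute_of_normal_of_disjoint A C hAn hCn (disjoint_iff.2 hdisj) a c ha hc).map
      G.subtype
  have hfin : (A.map G.subtype ⊔ C.map G.subtype).FiniteIndex := by
    rwa [← Subgroup.map_sup, hsup, ← MonoidHom.range_eq_map, Subgroup.range_subtype]
  rcases hR.eq_bot_or_eq_bot hR.two_lt_card hfin cs hcomm with h | h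
  · exact hA ((Subgroup.map_eq_bot_iff_of_injective A G.subtype_injective).1 h)
  · exact hC ((Subgroup.map_eq_bot_iff_of_injective C G.subtype_injective).1 h)

end CoxeterPaper
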